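/- arXiv:2009.10957 — 2 statements merged into one kernel-verified Lean document; each statement's English description precedes it below -/
import Mathlib

section
/- Let N ≥ 2, s ∈ (0,1), and μ ≥ μ_0. For every v ∈ C²_c(ℝ^N) and x ∈ ℝ^N∖{0}, the principal value limits defining (−Δ)^s (Γ_μ v)(x) and (−Δ)^s_{Γ_μ} v(x) exist and (−Δ)^s (Γ_μ v)(x) + μ |x|^{−2s} Γ_μ(x) v(x) = (−Δ)^s_{Γ_μ} v(x). Moreover, for every v ∈ C²_c(ℝ^N) and every u ∈ C²(ℝ^N) ∩ L¹(ℝ^N, dx/(1+|x|^{N+2s})), all integrals below converge absolutely and ∫_{ℝ^N} v(x) [(−Δ)^s u(x) + μ |x|^{−2s} u(x)] Γ_μ(x) dx = ∫_{ℝ^N} u(x) (−Δ)^s_{Γ_μ} v(x) dx. -/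
open MeasureTheory Filter Set Topology Metric

noncomputable section

/-- Euclidean space `ℝ^N`. -/
abbrev EN (N : ℕ) := EuclideanSpace ℝ (Fin N)

/-- The normalizing constant `C_{N,s}` of the fractional Laplacian. -/
def CNs (N : ℕ) (s : ℝ) : ℝ :=
  2 ^ (2*s) * Real.pi ^ (-(N:ℝ)/2) * s * Real.Gamma ((N + 2*s)/2) / Real.Gamma (1 - s)

/-- The optimal fractional Hardy constant `μ₀`. -/
def mu0 (N : ℕ) (s : ℝ) : ℝ :=
  -(2 ^ (2*s) * Real.Gamma ((N + 2*s)/4) ^ 2 / Real.Gamma ((N - 2*s)/4) ^ 2)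

/-- The function `τ ↦ c_s(τ)`. -/
def csFun (N : ℕ) (s τ : ℝ) : ℝ :=
  2 ^ (2*s) * Real.Gamma ((N + τ)/2) * Real.Gamma ((2*s - τ)/2) /
    (Real.Gamma (-τ/2) * Real.Gamma ((N - 2*s + τ)/2))

/-- `u` has fractional Laplacian `(-Δ)^s u (x) = L` at `x`, as a principal value. -/
def HasFracLap (N : ℕ) (s : ℝ) (u : EN N → ℝ) (x : EN N) (L : ℝ) : Prop :=
  Tendsto (fun ε : ℝ =>
      CNs N s * ∫ z in {z : EN N | ε ≤ dist x z}, (u x - u z) / dist x z ^ ((N:ℝ) + 2*s))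
    (𝓝[>] 0) (𝓝 L)

/-- `v` has weighted fractional Laplacian `(-Δ)^s_{Γ_μ} v (x) = L` at `x`, where the weight
is `Γ_μ(z) = ‖z‖ ^ τp` with `τp = τ₊(s,μ)`. -/
def HasWFracLap (N : ℕ) (s τp : ℝ) (v : EN N → ℝ) (x : EN N) (L : ℝ) : Prop :=
  Tendsto (fun ε : ℝ =>
      CNs N s * ∫ z in {z : EN N | ε ≤ dist x z},
        (v x - v z) * ‖z‖ ^ τp / dist x z ^ ((N:ℝ) + 2*s))
    (𝓝[>] 0) (𝓝 L)

/-- Membership in `L¹(ℝ^N, dx/(1+|x|^{N+2s}))`. -/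
def MemL1w (N : ℕ) (s : ℝ) (u : EN N → ℝ) : Prop :=
  Integrable (fun x : EN N => u x / (1 + ‖x‖ ^ ((N:ℝ) + 2*s)))

/-- Membership in `L^∞_loc(ℝ^N \ {0})`. -/
def LocBddAway (N : ℕ) (u : EN N → ℝ) : Prop :=
  ∀ K : Set (EN N), IsCompact K → (0:EN N) ∉ K → ∃ C : ℝ, ∀ x ∈ K, |u x| ≤ C

/-- Local `θ`-Hölder continuity on compact subsets of `S`, i.e. `C^θ_loc(S)`. -/
def HolderLocOn (N : ℕ) (θ : ℝ) (f : EN N → ℝ) (S : Set (EN N)) : Prop :=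
  ∀ K ⊆ S, IsCompact K → ∃ C : ℝ, ∀ x ∈ K, ∀ y ∈ K, |f x - f y| ≤ C * dist x y ^ θ

/-- Membership in `L^∞_loc(S)`. -/
def LinfLocOn (N : ℕ) (f : EN N → ℝ) (S : Set (EN N)) : Prop :=
  AEMeasurable f ∧ ∀ K ⊆ S, IsCompact K → ∃ C : ℝ, ∀ x ∈ K, |f x| ≤ C

/-- A bounded `C²` domain: open, connected and bounded, whose boundary is the regular zero
level set of a `C²` defining function. -/
structure IsBoundedC2Domain (N : ℕ) (Ω : Set (EN N)) : Prop where
  isOpen : IsOpen Ω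
  isConnected : IsConnected Ω
  isBounded : Bornology.IsBounded Ω
  c2Boundary : ∃ φ : EN N → ℝ, ContDiff ℝ 2 φ ∧ Ω = {x | φ x < 0} ∧
    ∀ x ∈ frontier Ω, fderiv ℝ φ x ≠ 0

/-- A bounded domain: open, connected and bounded. -/
def IsBoundedDomain (N : ℕ) (Ω : Set (EN N)) : Prop :=
  IsOpen Ω ∧ IsConnected Ω ∧ Bornology.IsBounded Ω

/-- The first standard coordinate vector `e₁ ∈ ℝ^N`. -/
def e1 (N : ℕ) : EN N :=
  (EuclideanSpace.equiv (Fin N) ℝ).symm (fun i => if (i:ℕ) = 0 then 1 else 0)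

/-- The surface measure `ω_{N-1}` of the unit sphere in `ℝ^N`. -/
def omegaN (N : ℕ) : ℝ := N * (volume (ball (0 : EN N) 1)).toReal

/-- The normalization constant `c_{s,0}`. -/
def cs0 (N : ℕ) (s : ℝ) : ℝ :=
  CNs N s * omegaN N * ∫ t in Ioo (0:ℝ) 1, ∫ z in ball (0:EN N) t,
    (‖z‖ ^ (2*s - N) - 1) / ‖e1 N - z‖ ^ ((N:ℝ) + 2*s)

/-- The fundamental solution `Φ_μ`, expressed via the exponent `τ = τ₋(s,μ)`:
`Φ_μ(x) = |x|^τ` for `μ ≠ μ₀` and `Φ_{μ₀}(x) = -|x|^τ ln |x|`. -/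
def Phi (N : ℕ) (s μ τ : ℝ) (x : EN N) : ℝ :=
  if μ = mu0 N s then -(‖x‖ ^ τ * Real.log ‖x‖) else ‖x‖ ^ τ

/-- The integrand appearing in the definition of `c_{s,μ}`. -/
def cIntegrand (N : ℕ) (s μ τm τp : ℝ) (z : EN N) : ℝ :=
  if μ = mu0 N s then ‖z‖ ^ ((2*s - N)/2) * (-Real.log ‖z‖) / ‖e1 N - z‖ ^ ((N:ℝ) + 2*s)
  else (‖z‖ ^ τm - ‖z‖ ^ τp) / ‖e1 N - z‖ ^ ((N:ℝ) + 2*s)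

/-- The normalization constant `c_{s,μ}`. -/
def csmu (N : ℕ) (s μ τm τp : ℝ) : ℝ :=
  CNs N s * omegaN N * ∫ t in Ioo (0:ℝ) 1, ∫ z in ball (0:EN N) t, cIntegrand N s μ τm τp z

/-- The weight `Λ_μ`, expressed via `τp = τ₊(s,μ)`. -/
def Lam (N : ℕ) (s τp : ℝ) (x : EN N) : ℝ :=
  if 2*s - 1 < τp then 1
  else if τp < 2*s - 1 then ‖x‖ ^ (1 - 2*s + τp)
  else 1 + max (-Real.log ‖x‖) 0

/-- The quadratic form `E^s(u,v)`. -/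
def Es (N : ℕ) (s : ℝ) (u v : EN N → ℝ) : ℝ :=
  (CNs N s / 2) *
    ∫ p : EN N × EN N, (u p.1 - u p.2) * (v p.1 - v p.2) / dist p.1 p.2 ^ ((N:ℝ) + 2*s)

/-- The quadratic form `E^s_μ(u,v)`. -/
def Esmu (N : ℕ) (s μ : ℝ) (u v : EN N → ℝ) : ℝ :=
  Es N s u v + μ * ∫ x : EN N, u x * v x / ‖x‖ ^ (2*s)

/-- `E^s_{A,B}(u,u) < ∞`. -/
def FiniteEnergyOn (N : ℕ) (s : ℝ) (u : EN N → ℝ) (A B : Set (EN N)) : Prop :=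
  IntegrableOn (fun p : EN N × EN N => (u p.1 - u p.2)^2 / dist p.1 p.2 ^ ((N:ℝ) + 2*s)) (A ×ˢ B)

/-- Membership in `H^s(ℝ^N)`: locally `L²` with finite Gagliardo seminorm. -/
def MemHs (N : ℕ) (s : ℝ) (u : EN N → ℝ) : Prop :=
  (∀ K : Set (EN N), IsCompact K → IntegrableOn (fun x => (u x)^2) K) ∧
  FiniteEnergyOn N s u univ univ

/-- Membership in `H^s_0(Ω)`. -/
def MemHs0 (N : ℕ) (s : ℝ) (Ω : Set (EN N)) (u : EN N → ℝ) : Prop :=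
  MemHs N s u ∧ ∀ᵐ x : EN N, x ∉ Ω → u x = 0

/-- Membership in `W^s(Ω)`. -/
def MemWs (N : ℕ) (s : ℝ) (Ω : Set (EN N)) (u : EN N → ℝ) : Prop :=
  MemL1w N s u ∧ IntegrableOn (fun x => (u x)^2) Ω ∧
  ∃ Ω' : Set (EN N), IsOpen Ω' ∧ IsConnected Ω' ∧ closure Ω ⊆ Ω' ∧ FiniteEnergyOn N s u Ω Ω'

/-- Membership in `W^s_*(Ω)`. -/
def MemWsStar (N : ℕ) (s : ℝ) (Ω : Set (EN N)) (u : EN N → ℝ) : Prop :=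
  MemL1w N s u ∧ ∀ ε : ℝ, 0 < ε → MemWs N s (Ω \ closedBall 0 ε) u

/-- The distributional identity `L^s_μ u = f` in `Ω \ {0}`, tested against `C^∞_c(Ω\{0})`. -/
def DistrEq (N : ℕ) (s μ : ℝ) (Ω : Set (EN N)) (f u : EN N → ℝ) : Prop :=
  ∀ φ : EN N → ℝ, ContDiff ℝ (⊤ : ℕ∞) φ → HasCompactSupport φ → tsupport φ ⊆ Ω \ {0} →
    ∀ g : EN N → ℝ, (∀ x, HasFracLap N s φ x (g x)) →
      (∫ x, u x * g x) + μ * ∫ x, u x * φ x / ‖x‖ ^ (2*s) = ∫ x in Ω, f x * φ x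

/-- A distributional solution of `L^s_μ u = f` in `Ω \ {0}` with `u = 0` in `ℝ^N \ Ω`. -/
def IsDistrSol (N : ℕ) (s μ : ℝ) (Ω : Set (EN N)) (f u : EN N → ℝ) : Prop :=
  LocBddAway N u ∧ MemL1w N s u ∧ (∀ x ∉ Ω, u x = 0) ∧ DistrEq N s μ Ω f u

/-! One-dimensional integrals -/

lemma wd_gamma_integrable {a b : ℝ} (ha : 0 < a) (hb : 0 < b) :
    IntegrableOn (fun t : ℝ => t ^ (a - 1) * Real.exp (-(b * t))) (Ioi 0) := by
  refine .of_integral_ne_zero ?_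
  rw [Real.integral_rpow_mul_exp_neg_mul_Ioi ha hb]
  have := Real.Gamma_pos_of_pos ha
  positivity

/-- Frullani type integral. -/
lemma wd_frullani_aux {α a b : ℝ} (hα : -1 < α) (hα0 : α ≠ 0) (ha : 0 ≤ a) (hab : a ≤ b)
    (h : 0 < a ∨ α < 0) :
    IntegrableOn (fun l : ℝ => l ^ (α - 1) * (Real.exp (-(l * a)) - Real.exp (-(l * b)))) (Ioi 0) ∧
    ∫ l in Ioi (0:ℝ), l ^ (α - 1) * (Real.exp (-(l * a)) - Real.exp (-(l * b))) =
      Real.Gamma α * (a ^ (-α) - b ^ (-α)) := by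
  set F : ℝ × ℝ → ℝ := fun q => q.1 ^ ((α + 1) - 1) * Real.exp (-(q.2 * q.1)) with hF
  have hFm : Measurable F := by
    rw [hF]; fun_prop
  have hinner : ∀ t ∈ Ioc a b, ∫ l in Ioi (0:ℝ), F (l, t) = Real.Gamma (α + 1) * t ^ (-α - 1) := by
    intro t ht
    have htp : 0 < t := lt_of_le_of_lt ha ht.1
    simp only [hF]
    rw [Real.integral_rpow_mul_exp_neg_mul_Ioi (by linarith) htp, mul_comm, one_div,
      Real.inv_rpow htp.le, ← Real.rpow_neg htp.le]
    congr 2; ring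
  have hne : -α - 1 ≠ -1 := by intro h; apply hα0; linarith
  have hmain : -1 < -α - 1 ∨ -α - 1 ≠ -1 ∧ (0:ℝ) ∉ uIcc a b := by
    rcases h with h | h
    · right; refine ⟨hne, ?_⟩
      rw [uIcc_of_le hab]; intro h0; exact absurd h0.1 (not_le.mpr h)
    · left; linarith
  have hii : IntervalIntegrable (fun t : ℝ => t ^ (-α - 1)) volume a b := by
    rcases hmain with h | h
    · exact intervalIntegral.intervalIntegrable_rpow' h
    · exact intervalIntegral.intervalIntegrable_rpow (Or.inr h.2)
  have hi : IntegrableOn (fun t : ℝ => t ^ (-α - 1)) (Ioc a b) := hii.1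
  have hFi : Integrable F ((volume.restrict (Ioi (0:ℝ))).prod (volume.restrict (Ioc a b))) := by
    rw [integrable_prod_iff' hFm.aestronglyMeasurable]
    constructor
    · filter_upwards [ae_restrict_mem measurableSet_Ioc] with t ht
      exact wd_gamma_integrable (by linarith) (lt_of_le_of_lt ha ht.1)
    · refine (hi.const_mul (Real.Gamma (α + 1))).congr ?_
      filter_upwards [ae_restrict_mem measurableSet_Ioc] with t ht
      rw [← hinner t ht]
      refine setIntegral_congr_fun measurableSet_Ioi fun l hl => ?_
      have hl' : (0:ℝ) < l := hl
      simp only [hF, Real.norm_eq_abs]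
      rw [abs_of_nonneg (by positivity)]
  have hinner2 : ∀ l ∈ Ioi (0:ℝ), ∫ t in Ioc a b, F (l, t) =
      l ^ (α - 1) * (Real.exp (-(l * a)) - Real.exp (-(l * b))) := by
    intro l hl
    have hl' : (0:ℝ) < l := hl
    rw [← intervalIntegral.integral_of_le hab]
    have hd : ∀ t ∈ uIcc a b, HasDerivAt (fun t : ℝ => -(l ^ (α - 1) * Real.exp (-(l * t))))
        (F (l, t)) t := by
      intro t _
      have h1 : HasDerivAt (fun t : ℝ => -(l * t)) (-l) t := by
        simpa using ((hasDerivAt_id' t).const_mul l).fun_neg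
      have h2 := ((h1.exp).const_mul (l ^ (α - 1))).fun_neg
      refine h2.congr_deriv ?_
      simp only [hF]
      rw [show α + 1 - 1 = (α - 1) + 1 by ring, Real.rpow_add hl', Real.rpow_one, mul_comm t l]
      ring
    rw [intervalIntegral.integral_eq_sub_of_hasDerivAt hd]
    · ring
    · apply Continuous.intervalIntegrable
      simp only [hF]; fun_prop
  constructor
  · refine hFi.integral_prod_left.congr ?_
    filter_upwards [ae_restrict_mem measurableSet_Ioi] with l hl
    exact hinner2 l hl
  · rw [← setIntegral_congr_fun measurableSet_Ioi hinner2]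
    have := integral_prod F hFi
    rw [← this, integral_prod_symm F hFi, setIntegral_congr_fun measurableSet_Ioc hinner,
      integral_const_mul, ← intervalIntegral.integral_of_le hab, integral_rpow hmain,
      Real.Gamma_add_one hα0]
    have : -α - 1 + 1 = -α := by ring
    rw [this]
    field_simp
    ring

lemma wd_frullani {α a b : ℝ} (hα : -1 < α) (hα0 : α ≠ 0) (ha : 0 < a) (hb : 0 < b) :
    IntegrableOn (fun l : ℝ => l ^ (α - 1) * (Real.exp (-(l * a)) - Real.exp (-(l * b)))) (Ioi 0) ∧
    ∫ l in Ioi (0:ℝ), l ^ (α - 1) * (Real.exp (-(l * a)) - Real.exp (-(l * b))) =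
      Real.Gamma α * (a ^ (-α) - b ^ (-α)) := by
  rcases le_total a b with h | h
  · exact wd_frullani_aux hα hα0 ha.le h (Or.inl ha)
  · obtain ⟨h1, h2⟩ := wd_frullani_aux hα hα0 hb.le h (Or.inl hb)
    have e : (fun l : ℝ => l ^ (α - 1) * (Real.exp (-(l * a)) - Real.exp (-(l * b)))) =
      fun l => - (l ^ (α - 1) * (Real.exp (-(l * b)) - Real.exp (-(l * a)))) := by
      funext l; ring
    rw [e]
    refine ⟨h1.neg, ?_⟩
    rw [integral_neg, h2]; ring

lemma wd_frullani_abs {α a b : ℝ} (hα : -1 < α) (hα0 : α ≠ 0) (ha : 0 < a) (hb : 0 < b) :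
    ∫ l in Ioi (0:ℝ), |l ^ (α - 1) * (Real.exp (-(l * a)) - Real.exp (-(l * b)))| =
      |Real.Gamma α * (a ^ (-α) - b ^ (-α))| := by
  rw [← (wd_frullani hα hα0 ha hb).2]
  rcases le_total a b with h | h
  · have hp : ∀ l ∈ Ioi (0:ℝ), 0 ≤ l ^ (α - 1) * (Real.exp (-(l * a)) - Real.exp (-(l * b))) := by
      intro l hl
      have hl' : (0:ℝ) < l := hl
      have : Real.exp (-(l * b)) ≤ Real.exp (-(l * a)) := by
        apply Real.exp_le_exp.mpr; nlinarith
      have : 0 ≤ Real.exp (-(l * a)) - Real.exp (-(l * b)) := by linarith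
      positivity
    rw [abs_of_nonneg (setIntegral_nonneg measurableSet_Ioi hp)]
    exact setIntegral_congr_fun measurableSet_Ioi fun l hl => abs_of_nonneg (hp l hl)
  · have hp : ∀ l ∈ Ioi (0:ℝ), l ^ (α - 1) * (Real.exp (-(l * a)) - Real.exp (-(l * b))) ≤ 0 := by
      intro l hl
      have hl' : (0:ℝ) < l := hl
      have h1 : Real.exp (-(l * a)) ≤ Real.exp (-(l * b)) := by
        apply Real.exp_le_exp.mpr; nlinarith
      have h2 : 0 ≤ l ^ (α - 1) := by positivity
      exact mul_nonpos_of_nonneg_of_nonpos h2 (by linarith)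
    rw [abs_of_nonpos (setIntegral_nonpos measurableSet_Ioi hp), ← integral_neg]
    exact setIntegral_congr_fun measurableSet_Ioi fun l hl => abs_of_nonpos (hp l hl)

/-- The final one-dimensional integral producing the constant. -/
lemma wd_const_integral {s c : ℝ} (hs : s ∈ Ioo (0:ℝ) 1) (hc : 0 < c) :
    ∫ v in Ioi (0:ℝ), v ^ (s + c - 1) * (v ^ (-c) - (1 + v) ^ (-c)) =
      Real.Gamma (s + c) * Real.Gamma (1 - s) / (s * Real.Gamma c) := by
  obtain ⟨hs0, hs1⟩ := hs
  have hGc := Real.Gamma_pos_of_pos hc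
  set F : ℝ × ℝ → ℝ := fun q => q.1 ^ (s + c - 1) * (q.2 ^ (c - 1) *
    (Real.exp (-(q.1 * q.2)) - Real.exp (-((1 + q.1) * q.2)))) with hF
  have hFm : Measurable F := by
    rw [hF]; fun_prop
  have hA : ∀ t ∈ Ioi (0:ℝ), ∫ v in Ioi (0:ℝ), F (v, t) =
      Real.Gamma (s + c) * (t ^ (-s - 1) * (Real.exp (-(t * 0)) - Real.exp (-(t * 1)))) := by
    intro t ht
    have ht' : (0:ℝ) < t := ht
    have e : ∀ v : ℝ, F (v, t) = (t ^ (c - 1) * (1 - Real.exp (-t))) *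
        (v ^ ((s + c) - 1) * Real.exp (-(t * v))) := by
      intro v
      simp only [hF]
      rw [show -((1 + v) * t) = -t + -(t * v) by ring, Real.exp_add, mul_comm v t]
      ring
    simp only [e]
    rw [integral_const_mul, Real.integral_rpow_mul_exp_neg_mul_Ioi (by linarith) ht', one_div,
      Real.inv_rpow ht'.le, ← Real.rpow_neg ht'.le]
    rw [show -s - 1 = (c - 1) + -(s + c) by ring, Real.rpow_add ht']
    simp; ring
  have hA0 := wd_frullani_aux (α := -s) (a := 0) (b := 1) (by linarith) (by linarith) le_rfl
    zero_le_one (Or.inr (by linarith))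
  have hFi : Integrable F ((volume.restrict (Ioi (0:ℝ))).prod (volume.restrict (Ioi (0:ℝ)))) := by
    rw [integrable_prod_iff' hFm.aestronglyMeasurable]
    constructor
    · filter_upwards [ae_restrict_mem measurableSet_Ioi] with t ht
      have ht' : (0:ℝ) < t := ht
      have e : ∀ v : ℝ, F (v, t) = (t ^ (c - 1) * (1 - Real.exp (-t))) *
        (v ^ ((s + c) - 1) * Real.exp (-(t * v))) := by
        intro v
        simp only [hF]
        rw [show -((1 + v) * t) = -t + -(t * v) by ring, Real.exp_add, mul_comm v t]
        ring
      simp only [e]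
      exact (wd_gamma_integrable (by linarith) ht').const_mul _
    · refine (hA0.1.const_mul (Real.Gamma (s + c))).congr ?_
      filter_upwards [ae_restrict_mem measurableSet_Ioi] with t ht
      rw [← hA t ht]
      refine setIntegral_congr_fun measurableSet_Ioi fun v hv => ?_
      have ht' : (0:ℝ) < t := ht
      have hv' : (0:ℝ) < v := hv
      have : Real.exp (-((1 + v) * t)) ≤ Real.exp (-(v * t)) := by
        apply Real.exp_le_exp.mpr; nlinarith
      have : 0 ≤ Real.exp (-(v * t)) - Real.exp (-((1 + v) * t)) := by linarith
      simp only [hF, Real.norm_eq_abs]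
      rw [abs_of_nonneg (by positivity)]
  have hB : ∀ v ∈ Ioi (0:ℝ), ∫ t in Ioi (0:ℝ), F (v, t) =
      Real.Gamma c * (v ^ (s + c - 1) * (v ^ (-c) - (1 + v) ^ (-c))) := by
    intro v hv
    have hv' : (0:ℝ) < v := hv
    have hv1 : (0:ℝ) < 1 + v := by linarith
    simp only [hF]
    rw [integral_const_mul]
    simp only [mul_sub]
    rw [integral_sub (wd_gamma_integrable hc hv') (wd_gamma_integrable hc hv1),
      Real.integral_rpow_mul_exp_neg_mul_Ioi hc hv', Real.integral_rpow_mul_exp_neg_mul_Ioi hc hv1,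
      one_div, one_div, Real.inv_rpow hv'.le, ← Real.rpow_neg hv'.le, Real.inv_rpow hv1.le,
      ← Real.rpow_neg hv1.le]
    ring
  have h := integral_prod F hFi
  rw [integral_prod_symm F hFi, setIntegral_congr_fun measurableSet_Ioi hA,
    setIntegral_congr_fun measurableSet_Ioi hB, integral_const_mul, integral_const_mul, hA0.2] at h
  have hG : Real.Gamma (1 - s) = -s * Real.Gamma (-s) := by
    rw [← Real.Gamma_add_one (by linarith)]; congr 1; ring
  rw [hG]
  have h0 : (0:ℝ) ^ (- -s) = 0 := Real.zero_rpow (by linarith)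
  rw [h0, Real.one_rpow] at h
  field_simp
  linarith

/-! Radial integrals -/

lemma wd_nontrivial {N : ℕ} (hN : 2 ≤ N) : Nontrivial (EN N) := by
  have : Nonempty (Fin N) := ⟨⟨0, by omega⟩⟩
  infer_instance

lemma wd_ball {N : ℕ} (hN : 2 ≤ N) {a : ℝ} (ha : -(N:ℝ) < a) :
    ∃ C : ℝ, 0 ≤ C ∧ ∀ ρ : ℝ, 0 < ρ → IntegrableOn (fun z : EN N => ‖z‖ ^ a) (ball 0 ρ) ∧
      ∫ z in ball (0 : EN N) ρ, ‖z‖ ^ a ≤ C * ρ ^ (a + N) := by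
  have := wd_nontrivial hN
  refine ⟨∫ z in ball (0 : EN N) 1, ‖z‖ ^ a, by positivity, fun ρ hρ => ⟨?_, ?_⟩⟩
  · rw [integrableOn_fun_norm_addHaar volume (f := fun t => t ^ a) (r := ρ)]
    have h1 : IntegrableOn (fun t : ℝ => t ^ ((N:ℝ) - 1 + a)) (Ioo 0 ρ) := by
      have := (intervalIntegral.intervalIntegrable_rpow' (a := 0) (b := ρ)
        (show -1 < (N:ℝ) - 1 + a by linarith)).1
      exact this.mono_set Ioo_subset_Ioc_self
    refine h1.congr_fun (fun t ht => ?_) measurableSet_Ioo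
    have ht0 : 0 < t := ht.1
    simp only [finrank_euclideanSpace_fin, smul_eq_mul]
    rw [Real.rpow_add ht0, ← Real.rpow_natCast, Nat.cast_sub (by omega)]
    simp
  · have h := Measure.setIntegral_comp_smul_of_pos (volume : Measure (EN N))
      (fun z : EN N => ‖z‖ ^ a) (ball (0:EN N) 1) hρ
    rw [smul_unitBall hρ.ne', Real.norm_of_nonneg hρ.le] at h
    simp only [finrank_euclideanSpace_fin, smul_eq_mul, norm_smul, Real.norm_of_nonneg hρ.le] at h
    simp_rw [Real.mul_rpow hρ.le (norm_nonneg _)] at h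
    rw [integral_const_mul] at h
    rw [Real.rpow_add hρ, Real.rpow_natCast]
    have hp : 0 < ρ ^ N := by positivity
    field_simp at h
    linarith

lemma wd_ext_meas {N : ℕ} (ρ : ℝ) : MeasurableSet {z : EN N | ρ ≤ ‖z‖} :=
  measurableSet_le measurable_const measurable_norm

open scoped Pointwise in
lemma wd_ext {N : ℕ} (hN : 2 ≤ N) {a : ℝ} (ha : a < -(N:ℝ)) :
    ∃ C : ℝ, 0 ≤ C ∧ ∀ ρ : ℝ, 0 < ρ → IntegrableOn (fun z : EN N => ‖z‖ ^ a) {z | ρ ≤ ‖z‖} ∧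
      ∫ z in {z : EN N | ρ ≤ ‖z‖}, ‖z‖ ^ a ≤ C * ρ ^ (a + N) := by
  have := wd_nontrivial hN
  refine ⟨∫ z in {z : EN N | 1 ≤ ‖z‖}, ‖z‖ ^ a, by positivity, fun ρ hρ => ⟨?_, ?_⟩⟩
  · have e : (indicator {z : EN N | ρ ≤ ‖z‖} fun z => ‖z‖ ^ a) =
        fun z : EN N => (indicator (Ici ρ) fun t => t ^ a) ‖z‖ := by
      funext z; simp [indicator]
    rw [← integrable_indicator_iff (wd_ext_meas ρ), e,
      integrable_fun_norm_addHaar volume (f := indicator (Ici ρ) fun t => t ^ a)]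
    have h1 : IntegrableOn (fun t : ℝ => t ^ ((N:ℝ) - 1 + a)) (Ioi ρ) :=
      integrableOn_Ioi_rpow_of_lt (by linarith) hρ
    rw [← integrableOn_Ici_iff_integrableOn_Ioi, ← integrable_indicator_iff measurableSet_Ici] at h1
    refine h1.integrableOn.congr_fun (fun t ht => ?_) measurableSet_Ioi
    have ht0 : 0 < t := ht
    simp only [finrank_euclideanSpace_fin, smul_eq_mul, indicator]
    split_ifs
    · rw [Real.rpow_add ht0, ← Real.rpow_natCast, Nat.cast_sub (by omega)]
      simp
    · simp
  · have h := Measure.setIntegral_comp_smul_of_pos (volume : Measure (EN N))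
      (fun z : EN N => ‖z‖ ^ a) {z : EN N | 1 ≤ ‖z‖} hρ
    have e : ρ • {z : EN N | 1 ≤ ‖z‖} = {z : EN N | ρ ≤ ‖z‖} := by
      ext z
      rw [mem_smul_set_iff_inv_smul_mem₀ hρ.ne']
      simp only [mem_ofPred_eq, norm_smul, norm_inv, Real.norm_of_nonneg hρ.le]
      rw [← div_eq_inv_mul, le_div_iff₀ hρ, one_mul]
    rw [e] at h
    simp only [finrank_euclideanSpace_fin, smul_eq_mul, norm_smul, Real.norm_of_nonneg hρ.le] at h
    simp_rw [Real.mul_rpow hρ.le (norm_nonneg _)] at h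
    rw [integral_const_mul] at h
    rw [Real.rpow_add hρ, Real.rpow_natCast]
    have hp : 0 < ρ ^ N := by positivity
    field_simp at h
    linarith

/-! Symmetrization -/

/-- Symmetric second difference. -/
def wdS {N : ℕ} (w : EN N → ℝ) (x y : EN N) : ℝ := w x - (w (x + y) + w (x - y)) / 2

/-- Truncated integral. -/
def wdT (N : ℕ) (s : ℝ) (ε : ℝ) (w : EN N → ℝ) (x : EN N) : ℝ :=
  ∫ z in {z : EN N | ε ≤ dist x z}, (w x - w z) / dist x z ^ ((N:ℝ) + 2*s)

lemma wd_kernel_bound {N : ℕ} {s : ℝ} (hs : 0 < s) {R ε : ℝ} (hR : 0 ≤ R) (hε : 0 < ε) :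
    ∃ C : ℝ, 0 < C ∧ ∀ x z : EN N, ‖x‖ ≤ R → ε ≤ dist x z →
      1 + ‖z‖ ^ ((N:ℝ) + 2*s) ≤ C * dist x z ^ ((N:ℝ) + 2*s) := by
  have hp : 0 < (N:ℝ) + 2*s := by positivity
  refine ⟨(1/ε) ^ ((N:ℝ) + 2*s) + (R/ε + 1) ^ ((N:ℝ) + 2*s), by positivity, fun x z hx hd => ?_⟩
  have hd0 : 0 < dist x z := lt_of_lt_of_le hε hd
  rw [add_mul, ← Real.mul_rpow (by positivity) hd0.le, ← Real.mul_rpow (by positivity) hd0.le]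
  have hde : 1 ≤ dist x z / ε := by rw [le_div_iff₀ hε]; linarith
  gcongr
  · apply Real.one_le_rpow _ hp.le
    rw [one_div, ← div_eq_inv_mul]; exact hde
  · have h1 : ‖z‖ ≤ ‖x‖ + dist x z := by
      rw [dist_comm, dist_eq_norm]
      calc ‖z‖ = ‖x + (z - x)‖ := by congr 1; abel
        _ ≤ _ := norm_add_le _ _
    have : R ≤ R / ε * dist x z := by
      rw [div_mul_eq_mul_div, mul_div_assoc]
      exact le_mul_of_one_le_right hR hde
    linarith

lemma wd_distset_meas {N : ℕ} (x : EN N) (ε : ℝ) : MeasurableSet {z : EN N | ε ≤ dist x z} :=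
  measurableSet_le measurable_const (by fun_prop)

lemma wd_aesm {N : ℕ} {s : ℝ} {w : EN N → ℝ} (hw : MemL1w N s w) : AEStronglyMeasurable w := by
  have h1 := hw.aestronglyMeasurable.mul
    (show AEStronglyMeasurable (fun x : EN N => 1 + ‖x‖ ^ ((N:ℝ) + 2*s)) volume from
      (by fun_prop : Measurable (fun x : EN N => 1 + ‖x‖ ^ ((N:ℝ) + 2*s))).aestronglyMeasurable)
  refine h1.congr (ae_of_all _ fun x => ?_)
  simp only [Pi.mul_apply]
  have : 0 < 1 + ‖x‖ ^ ((N:ℝ) + 2*s) := by positivity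
  field_simp

lemma wd_far_integrable {N : ℕ} {s : ℝ} (hs : 0 < s) {w : EN N → ℝ} (hw : MemL1w N s w)
    (x : EN N) {ε : ℝ} (hε : 0 < ε) :
    IntegrableOn (fun z => w z / dist x z ^ ((N:ℝ) + 2*s)) {z : EN N | ε ≤ dist x z} := by
  obtain ⟨C, hC, h⟩ := wd_kernel_bound (N := N) hs (norm_nonneg x) hε
  refine Integrable.mono' ((hw.norm.const_mul C).integrableOn) ?_ ?_
  · exact ((wd_aesm hw).restrict.mul
      (by fun_prop : Measurable (fun z : EN N => (dist x z ^ ((N:ℝ) + 2*s))⁻¹)).aestronglyMeasurable)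
  · filter_upwards [ae_restrict_mem (wd_distset_meas x ε)] with z hz
    have hd0 : 0 < dist x z := lt_of_lt_of_le hε hz
    have h1 := h x z le_rfl hz
    have h2 : 0 < 1 + ‖z‖ ^ ((N:ℝ) + 2*s) := by positivity
    have h3 : 0 < dist x z ^ ((N:ℝ) + 2*s) := by positivity
    rw [norm_div, norm_div, Real.norm_of_nonneg h2.le, Real.norm_of_nonneg h3.le,
      ← mul_div_assoc, div_le_div_iff₀ h3 h2]
    nlinarith [norm_nonneg (w z)]

lemma wd_one_memL1w {N : ℕ} (hN : 2 ≤ N) {s : ℝ} (hs : 0 < s) : MemL1w N s (fun _ => (1:ℝ)) := by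
  unfold MemL1w
  obtain ⟨C, -, hC⟩ := wd_ext hN (a := -((N:ℝ) + 2*s)) (by linarith)
  have hm : Measurable (fun x : EN N => (1:ℝ) / (1 + ‖x‖ ^ ((N:ℝ) + 2*s))) := by fun_prop
  rw [← integrableOn_univ, ← compl_union_self {z : EN N | 1 ≤ ‖z‖}, integrableOn_union]
  constructor
  · have hb : {z : EN N | 1 ≤ ‖z‖}ᶜ = ball 0 1 := by ext z; simp
    rw [hb]
    refine Integrable.mono' (integrableOn_const (C := (1:ℝ)) (by exact measure_ball_lt_top.ne)) hm.aestronglyMeasurable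
      (ae_of_all _ fun z => ?_)
    have : 0 ≤ ‖z‖ ^ ((N:ℝ) + 2*s) := by positivity
    rw [Real.norm_of_nonneg (by positivity), div_le_one (by positivity)]
    linarith
  · refine Integrable.mono' (hC 1 one_pos).1 hm.aestronglyMeasurable ?_
    filter_upwards [ae_restrict_mem (wd_ext_meas 1)] with z hz
    have hz0 : 0 < ‖z‖ := lt_of_lt_of_le one_pos hz
    have : 0 < ‖z‖ ^ ((N:ℝ) + 2*s) := by positivity
    rw [Real.norm_of_nonneg (by positivity), Real.rpow_neg hz0.le, ← one_div]
    gcongr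
    linarith

lemma wd_diff_integrable {N : ℕ} (hN : 2 ≤ N) {s : ℝ} (hs : 0 < s) {w : EN N → ℝ}
    (hw : MemL1w N s w) (x : EN N) (c : ℝ) {ε : ℝ} (hε : 0 < ε) :
    IntegrableOn (fun z => (c - w z) / dist x z ^ ((N:ℝ) + 2*s)) {z : EN N | ε ≤ dist x z} := by
  have h1 := (wd_far_integrable hs (wd_one_memL1w hN hs) x hε).const_mul c
  refine (h1.sub (wd_far_integrable hs hw x hε)).congr (ae_of_all _ fun z => ?_)
  simp only [Pi.sub_apply]
  ring

/-- Symmetrization of an integral over the complement of a ball around `x`. -/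
lemma wd_symm_gen {N : ℕ} (x : EN N) (ε : ℝ) (f : EN N → ℝ)
    (hf : IntegrableOn f {z : EN N | ε ≤ dist x z}) :
    IntegrableOn (fun y => (f (x + y) + f (x - y)) / 2) {y : EN N | ε ≤ ‖y‖} ∧
    ∫ z in {z : EN N | ε ≤ dist x z}, f z =
      ∫ y in {y : EN N | ε ≤ ‖y‖}, (f (x + y) + f (x - y)) / 2 := by
  have e : (indicator {y : EN N | ε ≤ ‖y‖} fun y => (f (x + y) + f (x - y)) / 2) =
      fun y => ((indicator {z : EN N | ε ≤ dist x z} f) (x + y) +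
        (indicator {z : EN N | ε ≤ dist x z} f) (x - y)) / 2 := by
    funext y
    simp only [indicator, mem_ofPred_eq, dist_self_add_right, dist_self_sub_right]
    split_ifs <;> simp
  rw [← integrable_indicator_iff (wd_distset_meas x ε)] at hf
  rw [← integrable_indicator_iff (wd_ext_meas ε), ← integral_indicator (wd_distset_meas x ε),
    ← integral_indicator (wd_ext_meas ε), e]
  have h1 := hf.comp_add_left x
  have h2 := hf.comp_sub_left x
  refine ⟨(h1.add h2).div_const 2, ?_⟩
  rw [integral_div, integral_add h1 h2, integral_add_left_eq_self, integral_sub_left_eq_self]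
  ring

lemma wd_symm {N : ℕ} (hN : 2 ≤ N) {s : ℝ} (hs : 0 < s) {w : EN N → ℝ}
    (hw : MemL1w N s w) (x : EN N) {ε : ℝ} (hε : 0 < ε) :
    IntegrableOn (fun y => wdS w x y / ‖y‖ ^ ((N:ℝ) + 2*s)) {y : EN N | ε ≤ ‖y‖} ∧
    wdT N s ε w x = ∫ y in {y : EN N | ε ≤ ‖y‖}, wdS w x y / ‖y‖ ^ ((N:ℝ) + 2*s) := by
  have h := wd_symm_gen x ε _ (wd_diff_integrable hN hs hw x (w x) hε)
  have e : (fun y : EN N => ((w x - w (x + y)) / dist x (x + y) ^ ((N:ℝ) + 2*s) +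
      (w x - w (x - y)) / dist x (x - y) ^ ((N:ℝ) + 2*s)) / 2) =
      fun y => wdS w x y / ‖y‖ ^ ((N:ℝ) + 2*s) := by
    funext y
    rw [dist_self_add_right, dist_self_sub_right, wdS]
    ring
  rw [e] at h
  exact h

lemma wd_ne_zero_ae {N : ℕ} (hN : 2 ≤ N) (a : EN N) : ∀ᵐ y : EN N, y ≠ a := by
  have := wd_nontrivial hN
  have : (volume : Measure (EN N)) {a} = 0 := measure_singleton a
  exact compl_mem_ae_iff.mpr this

lemma wd_limit {N : ℕ} (hN : 2 ≤ N) {s : ℝ} (hs : 0 < s) {w : EN N → ℝ}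
    (hw : MemL1w N s w) (x : EN N)
    (hi : Integrable (fun y => wdS w x y / ‖y‖ ^ ((N:ℝ) + 2*s))) :
    HasFracLap N s w x (CNs N s * ∫ y, wdS w x y / ‖y‖ ^ ((N:ℝ) + 2*s)) := by
  refine Tendsto.const_mul _ ?_
  have e : (fun ε : ℝ => ∫ y, indicator {y : EN N | ε ≤ ‖y‖}
      (fun y => wdS w x y / ‖y‖ ^ ((N:ℝ) + 2*s)) y) =ᶠ[𝓝[>] 0]
      fun ε : ℝ => ∫ z in {z : EN N | ε ≤ dist x z}, (w x - w z) / dist x z ^ ((N:ℝ) + 2*s) := by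
    filter_upwards [self_mem_nhdsWithin] with ε hε
    rw [integral_indicator (wd_ext_meas ε), ← (wd_symm hN hs hw x hε).2, wdT]
  refine Tendsto.congr' e ?_
  refine tendsto_integral_filter_of_dominated_convergence _ ?_ ?_ hi.norm ?_
  · exact Eventually.of_forall fun ε => hi.aestronglyMeasurable.indicator (wd_ext_meas ε)
  · refine Eventually.of_forall fun ε => ae_of_all _ fun y => ?_
    exact norm_indicator_le_norm_self _ _
  · filter_upwards [wd_ne_zero_ae hN 0] with y hy
    refine tendsto_const_nhds.congr' ?_
    have hy0 : 0 < ‖y‖ := norm_pos_iff.mpr hy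
    have : ∀ᶠ ε : ℝ in 𝓝[>] 0, ε ≤ ‖y‖ :=
      (mem_nhdsWithin_of_mem_nhds (Iic_mem_nhds hy0))
    filter_upwards [this] with ε hε
    rw [indicator_of_mem]; exact hε

lemma wd_S_aesm {N : ℕ} {s : ℝ} {w : EN N → ℝ} (hw : MemL1w N s w) (x : EN N) :
    AEStronglyMeasurable (fun y => wdS w x y / ‖y‖ ^ ((N:ℝ) + 2*s)) := by
  have h1 := (wd_aesm hw).comp_measurePreserving (measurePreserving_add_left volume x)
  have h2 := (wd_aesm hw).comp_measurePreserving (Measure.measurePreserving_sub_left volume x)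
  have h3 : AEStronglyMeasurable (fun y : EN N => (‖y‖ ^ ((N:ℝ) + 2*s))⁻¹) volume :=
    (by fun_prop : Measurable (fun y : EN N => (‖y‖ ^ ((N:ℝ) + 2*s))⁻¹)).aestronglyMeasurable
  have h4 : AEStronglyMeasurable (fun _ : EN N => w x) volume := aestronglyMeasurable_const
  have h5 : AEStronglyMeasurable (fun _ : EN N => (2:ℝ)⁻¹) volume := aestronglyMeasurable_const
  refine ((h4.sub ((h1.add h2).mul h5)).mul h3).congr (ae_of_all _ fun y => ?_)
  simp only [Pi.mul_apply, Pi.sub_apply, Pi.add_apply, Function.comp, wdS]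
  ring

lemma wd_bound {N : ℕ} (hN : 2 ≤ N) {s : ℝ} (hs : s ∈ Ioo (0:ℝ) 1) :
    ∃ C : ℝ, 0 ≤ C ∧ ∀ w : EN N → ℝ, MemL1w N s w → ∀ (x : EN N) (ρ A : ℝ), 0 < ρ →  0 ≤ A →
      (∀ y : EN N, ‖y‖ < ρ → |wdS w x y| ≤ A * ‖y‖ ^ 2) →
      Integrable (fun y => wdS w x y / ‖y‖ ^ ((N:ℝ) + 2*s)) ∧
      ∀ ε : ℝ, 0 < ε → |wdT N s ε w x| ≤ C * (A * ρ ^ (2 - 2*s) + |w x| * ρ ^ (-(2*s))) +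
        ∫ z in {z : EN N | ρ ≤ dist x z}, |w z| / dist x z ^ ((N:ℝ) + 2*s) := by
  obtain ⟨hs0, hs1⟩ := hs
  obtain ⟨C1, hC1, h1⟩ := wd_ball hN (a := 2 - ((N:ℝ) + 2*s)) (by linarith)
  obtain ⟨C2, hC2, h2⟩ := wd_ext hN (a := -((N:ℝ) + 2*s)) (by linarith)
  refine ⟨C1 + C2, by positivity, fun w hw x ρ A hρ hA hS => ?_⟩
  have hm := wd_S_aesm hw x
  have hnear : ∀ y ∈ ball (0:EN N) ρ, ‖wdS w x y / ‖y‖ ^ ((N:ℝ) + 2*s)‖ ≤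
      A * ‖y‖ ^ (2 - ((N:ℝ) + 2*s)) := by
    intro y hy
    rw [mem_ball_zero_iff] at hy
    rcases eq_or_ne y 0 with rfl | h0
    · have : wdS w x 0 = 0 := by simp [wdS]
      rw [this]; simp only [zero_div, norm_zero]; positivity
    · have hy0 : 0 < ‖y‖ := norm_pos_iff.mpr h0
      rw [norm_div, Real.norm_of_nonneg (by positivity : 0 ≤ ‖y‖ ^ ((N:ℝ) + 2*s)),
        Real.rpow_sub hy0, ← mul_div_assoc, Real.rpow_two]
      gcongr
      exact hS y hy
  have hib : IntegrableOn (fun y => wdS w x y / ‖y‖ ^ ((N:ℝ) + 2*s)) (ball 0 ρ) := by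
    refine Integrable.mono' ((h1 ρ hρ).1.const_mul A) hm.restrict ?_
    filter_upwards [ae_restrict_mem measurableSet_ball] with y hy using hnear y hy
  have hie := (wd_symm hN hs0 hw x hρ).1
  have hcompl : (ball (0:EN N) ρ)ᶜ = {y : EN N | ρ ≤ ‖y‖} := by ext; simp
  have hInt1 : Integrable (fun y => wdS w x y / ‖y‖ ^ ((N:ℝ) + 2*s)) := by
    rw [← integrableOn_univ, ← union_compl_self (ball (0:EN N) ρ), integrableOn_union, hcompl]
    exact ⟨hib, hie⟩
  refine ⟨hInt1, fun ε hε => ?_⟩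
  have habs : IntegrableOn (fun z => |w z| / dist x z ^ ((N:ℝ) + 2*s)) {z : EN N | ρ ≤ dist x z} := by
    refine (wd_far_integrable hs0 hw x hρ).norm.congr (ae_of_all _ fun z => ?_)
    simp only [norm_div]
    rw [Real.norm_of_nonneg (by positivity : 0 ≤ dist x z ^ ((N:ℝ) + 2*s)), Real.norm_eq_abs]
  obtain ⟨hsy1, hsy2⟩ := wd_symm_gen x ρ _ habs
  rw [(wd_symm hN hs0 hw x hε).2]
  have hpow1 : 2 - ((N:ℝ) + 2*s) + N = 2 - 2*s := by ring
  have hpow2 : -((N:ℝ) + 2*s) + N = -(2*s) := by ring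
  have b1 : ∫ y in ball (0:EN N) ρ, ‖wdS w x y / ‖y‖ ^ ((N:ℝ) + 2*s)‖ ≤
      A * (C1 * ρ ^ (2 - 2*s)) := by
    calc _ ≤ ∫ y in ball (0:EN N) ρ, A * ‖y‖ ^ (2 - ((N:ℝ) + 2*s)) :=
          setIntegral_mono_on hib.norm ((h1 ρ hρ).1.const_mul A) measurableSet_ball hnear
      _ ≤ _ := by
          rw [integral_const_mul]
          have := (h1 ρ hρ).2
          rw [hpow1] at this
          gcongr
  have b2 : ∫ y in {y : EN N | ρ ≤ ‖y‖}, ‖wdS w x y / ‖y‖ ^ ((N:ℝ) + 2*s)‖ ≤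
      |w x| * (C2 * ρ ^ (-(2*s))) +
        ∫ z in {z : EN N | ρ ≤ dist x z}, |w z| / dist x z ^ ((N:ℝ) + 2*s) := by
    have i1 := (h2 ρ hρ).1.const_mul |w x|
    calc _ ≤ ∫ y in {y : EN N | ρ ≤ ‖y‖}, (|w x| * ‖y‖ ^ (-((N:ℝ) + 2*s)) +
            (|w (x + y)| / dist x (x + y) ^ ((N:ℝ) + 2*s) +
              |w (x - y)| / dist x (x - y) ^ ((N:ℝ) + 2*s)) / 2) := by
          refine setIntegral_mono_on hie.norm (i1.add hsy1) (wd_ext_meas ρ) fun y hy => ?_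
          have hy0 : 0 < ‖y‖ := lt_of_lt_of_le hρ hy
          have hp : 0 < ‖y‖ ^ ((N:ℝ) + 2*s) := by positivity
          rw [dist_self_add_right, dist_self_sub_right, norm_div, Real.norm_of_nonneg hp.le,
            Real.rpow_neg hy0.le, Real.norm_eq_abs]
          have : |wdS w x y| ≤ |w x| + (|w (x + y)| + |w (x - y)|) / 2 := by
            unfold wdS
            rw [abs_le]
            have a1 := abs_le.mp (le_refl |w x|)
            have a2 := abs_le.mp (le_refl |w (x + y)|)
            have a3 := abs_le.mp (le_refl |w (x - y)|)
            constructor <;> linarith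
          calc _ ≤ (|w x| + (|w (x + y)| + |w (x - y)|) / 2) / ‖y‖ ^ ((N:ℝ) + 2*s) := by gcongr
            _ = _ := by ring
      _ ≤ _ := by
          rw [integral_add i1 hsy1, integral_const_mul, ← hsy2]
          have := (h2 ρ hρ).2
          rw [hpow2] at this
          gcongr
  calc |∫ y in {y : EN N | ε ≤ ‖y‖}, wdS w x y / ‖y‖ ^ ((N:ℝ) + 2*s)|
      ≤ ∫ y in {y : EN N | ε ≤ ‖y‖}, ‖wdS w x y / ‖y‖ ^ ((N:ℝ) + 2*s)‖ :=
        by rw [← Real.norm_eq_abs]; exact norm_integral_le_integral_norm _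
    _ ≤ ∫ y, ‖wdS w x y / ‖y‖ ^ ((N:ℝ) + 2*s)‖ :=
        setIntegral_le_integral hInt1.norm (ae_of_all _ fun _ => norm_nonneg _)
    _ = (∫ y in ball (0:EN N) ρ, ‖wdS w x y / ‖y‖ ^ ((N:ℝ) + 2*s)‖) +
        ∫ y in {y : EN N | ρ ≤ ‖y‖}, ‖wdS w x y / ‖y‖ ^ ((N:ℝ) + 2*s)‖ := by
        rw [← hcompl]
        exact (integral_add_compl measurableSet_ball hInt1.norm).symm
    _ ≤ _ := by
        have e1 : 0 ≤ A * (C2 * ρ ^ (2 - 2*s)) := by positivity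
        have e2 : 0 ≤ |w x| * (C1 * ρ ^ (-(2*s))) := by positivity
        nlinarith

/-! Second difference bounds -/

lemma wd_taylor {N : ℕ} {F : EN N → ℝ} {U K : Set (EN N)} (hU : IsOpen U)
    (hF : ContDiffOn ℝ 2 F U) (hK : IsCompact K) (hKU : K ⊆ U) :
    ∃ M : ℝ, 0 ≤ M ∧ ∀ (x : EN N) (ρ : ℝ), ball x ρ ⊆ K → ∀ y : EN N, ‖y‖ < ρ →
      |wdS F x y| ≤ M * ‖y‖ ^ 2 ∧ |F (x + y) - F x| ≤ M * ‖y‖ := by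
  have h1 : ContDiffOn ℝ 1 (fderiv ℝ F) U := hF.fderiv_of_isOpen hU (by norm_num)
  have h2 : ContinuousOn (fderiv ℝ (fderiv ℝ F)) U := h1.continuousOn_fderiv_of_isOpen hU (by norm_num)
  obtain ⟨M1, hM1⟩ := hK.exists_bound_of_continuousOn (h1.continuousOn.mono hKU)
  obtain ⟨M2, hM2⟩ := hK.exists_bound_of_continuousOn (f := fderiv ℝ (fderiv ℝ F)) (h2.mono hKU)
  have hd : ∀ z ∈ U, DifferentiableAt ℝ F z := fun z hz =>
    (hF.contDiffAt (hU.mem_nhds hz)).differentiableAt (by norm_num)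
  have hd1 : ∀ z ∈ U, DifferentiableAt ℝ (fderiv ℝ F) z := fun z hz =>
    (h1.contDiffAt (hU.mem_nhds hz)).differentiableAt (by norm_num)
  refine ⟨max (max M1 M2) 0, le_max_right _ _, fun x ρ hb y hy => ?_⟩
  set M := max (max M1 M2) 0 with hM
  have hM1' : M1 ≤ M := le_trans (le_max_left _ _) (le_max_left _ _)
  have hM2' : M2 ≤ M := le_trans (le_max_right _ _) (le_max_left _ _)
  have hρ : 0 < ρ := lt_of_le_of_lt (norm_nonneg y) hy
  have hsub : closedBall x ‖y‖ ⊆ ball x ρ := closedBall_subset_ball hy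
  have hxm : x ∈ closedBall x ‖y‖ := mem_closedBall_self (norm_nonneg _)
  have hlip : ∀ z ∈ closedBall x ‖y‖, ‖fderiv ℝ F z - fderiv ℝ F x‖ ≤ M * ‖y‖ := by
    intro z hz
    have := (convex_closedBall x ‖y‖).norm_image_sub_le_of_norm_fderiv_le
      (fun z hz => hd1 z (hKU (hb (hsub hz))))
      (fun z hz => (hM2 z (hb (hsub hz))).trans hM2') hxm hz
    refine this.trans ?_
    have h3 : ‖z - x‖ ≤ ‖y‖ := by rw [← dist_eq_norm]; exact hz
    have : 0 ≤ M := le_max_right _ _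
    gcongr
  have hT : ∀ z ∈ closedBall x ‖y‖, ‖F z - F x - fderiv ℝ F x (z - x)‖ ≤ M * ‖y‖ * ‖z - x‖ :=
    fun z hz => (convex_closedBall x ‖y‖).norm_image_sub_le_of_norm_fderiv_le'
      (fun z hz => hd z (hKU (hb (hsub hz)))) hlip hxm hz
  have hp : x + y ∈ closedBall x ‖y‖ := by simp
  have hmi : x - y ∈ closedBall x ‖y‖ := by simp
  constructor
  · have a := hT _ hp
    have b := hT _ hmi
    rw [show x + y - x = y by abel] at a
    rw [show x - y - x = -y by abel, map_neg, norm_neg] at b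
    rw [Real.norm_eq_abs] at a b
    unfold wdS
    rw [abs_le] at a b ⊢
    constructor <;> nlinarith
  · have := (convex_closedBall x ‖y‖).norm_image_sub_le_of_norm_fderiv_le
      (fun z hz => hd z (hKU (hb (hsub hz))))
      (fun z hz => (hM1 z (hb (hsub hz))).trans hM1') hxm hp
    rwa [show x + y - x = y by abel] at this

lemma wd_norm_rpow_contDiff {N : ℕ} (τ : ℝ) :
    ContDiffOn ℝ 2 (fun z : EN N => ‖z‖ ^ τ) {z | z ≠ 0} := by
  intro z hz
  have hz' : z ≠ 0 := hz
  exact ((contDiffAt_norm ℝ hz').rpow_const_of_ne (norm_ne_zero_iff.mpr hz')).contDiffWithinAt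

lemma wd_gamma_taylor {N : ℕ} (τ : ℝ) :
    ∃ M : ℝ, 0 ≤ M ∧ ∀ x : EN N, x ≠ 0 → ∀ y : EN N, ‖y‖ < ‖x‖ / 2 →
      |wdS (fun z : EN N => ‖z‖ ^ τ) x y| ≤ M * ‖x‖ ^ (τ - 2) * ‖y‖ ^ 2 ∧
      |‖x + y‖ ^ τ - ‖x‖ ^ τ| ≤ M * ‖x‖ ^ (τ - 1) * ‖y‖ := by
  have hK : IsCompact (closedBall (0:EN N) (3/2) ∩ {z | 1/2 ≤ ‖z‖}) :=
    (isCompact_closedBall _ _).inter_right (isClosed_le continuous_const continuous_norm)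
  obtain ⟨M, hM, h⟩ := wd_taylor (isOpen_ne : IsOpen {z : EN N | z ≠ 0})
    (wd_norm_rpow_contDiff (N := N) τ) hK (fun z hz => by
      have h1 : (1:ℝ)/2 ≤ ‖z‖ := hz.2
      have : 0 < ‖z‖ := by linarith
      exact norm_pos_iff.mp this)
  refine ⟨M, hM, fun x hx y hy => ?_⟩
  have hr : 0 < ‖x‖ := norm_pos_iff.mpr hx
  set r := ‖x‖ with hrdef
  set x' := r⁻¹ • x with hx'
  set y' := r⁻¹ • y with hy'
  have hx1 : ‖x'‖ = 1 := by
    rw [hx', norm_smul, norm_inv, Real.norm_of_nonneg hr.le, ← hrdef, inv_mul_cancel₀ hr.ne']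
  have hxe : x = r • x' := by rw [hx', smul_inv_smul₀ hr.ne']
  have hye : y = r • y' := by rw [hy', smul_inv_smul₀ hr.ne']
  have hyn : ‖y‖ = r * ‖y'‖ := by rw [hye, norm_smul, Real.norm_of_nonneg hr.le]
  have hy2 : ‖y'‖ < 1/2 := by
    rw [hyn] at hy
    have : r * ‖y'‖ < r * (1/2) := by linarith
    exact lt_of_mul_lt_mul_left this hr.le
  have hb : ball x' (1/2) ⊆ closedBall (0:EN N) (3/2) ∩ {z | 1/2 ≤ ‖z‖} := by
    intro z hz
    rw [mem_ball, dist_eq_norm] at hz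
    have h1 : ‖z‖ ≤ ‖x'‖ + ‖z - x'‖ := by
      calc ‖z‖ = ‖x' + (z - x')‖ := by congr 1; abel
        _ ≤ _ := norm_add_le _ _
    have h2 : ‖x'‖ ≤ ‖z‖ + ‖z - x'‖ := by
      calc ‖x'‖ = ‖z - (z - x')‖ := by congr 1; abel
        _ ≤ _ := norm_sub_le _ _
    constructor
    · rw [mem_closedBall_zero_iff]; linarith
    · change 1/2 ≤ ‖z‖; linarith
  obtain ⟨e1, e2⟩ := h x' (1/2) hb y' hy2
  have hsc : ∀ z : EN N, ‖r • z‖ ^ τ = r ^ τ * ‖z‖ ^ τ := fun z => by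
    rw [norm_smul, Real.norm_of_nonneg hr.le, Real.mul_rpow hr.le (norm_nonneg _)]
  constructor
  · have : wdS (fun z : EN N => ‖z‖ ^ τ) x y = r ^ τ * wdS (fun z : EN N => ‖z‖ ^ τ) x' y' := by
      unfold wdS
      simp only
      rw [hxe, hye, ← smul_add, ← smul_sub, hsc, hsc, hsc]
      ring
    rw [this, abs_mul, abs_of_pos (by positivity), hyn, Real.rpow_sub hr, Real.rpow_two]
    calc r ^ τ * |wdS (fun z : EN N => ‖z‖ ^ τ) x' y'| ≤ r ^ τ * (M * ‖y'‖ ^ 2) := by gcongr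
      _ = _ := by field_simp
  · have : ‖x + y‖ ^ τ - r ^ τ = r ^ τ * (‖x' + y'‖ ^ τ - ‖x'‖ ^ τ) := by
      rw [mul_sub, ← hsc, ← hsc, smul_add, ← hxe, ← hye, hrdef]
    rw [this, abs_mul, abs_of_pos (by positivity), hyn, Real.rpow_sub hr, Real.rpow_one]
    calc _ ≤ r ^ τ * (M * ‖y'‖) := by gcongr
      _ = _ := by field_simp

lemma wd_prod_taylor {N : ℕ} (τ : ℝ) {v : EN N → ℝ} (hv : ContDiff ℝ 2 v) {R : ℝ} (hR : 0 ≤ R) :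
    ∃ M : ℝ, 0 ≤ M ∧ ∀ x : EN N, x ≠ 0 → ‖x‖ ≤ R → ∀ y : EN N, ‖y‖ < ‖x‖ / 2 →
      |wdS (fun z : EN N => ‖z‖ ^ τ * v z) x y| ≤ M * ‖x‖ ^ (τ - 2) * ‖y‖ ^ 2 := by
  obtain ⟨M1, hM1, h1⟩ := wd_gamma_taylor (N := N) τ
  obtain ⟨M2, hM2, h2⟩ := wd_taylor isOpen_univ hv.contDiffOn
    (isCompact_closedBall (0:EN N) (2*R)) (subset_univ _)
  obtain ⟨M3, hM3⟩ := (isCompact_closedBall (0:EN N) R).exists_bound_of_continuousOn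
    hv.continuous.continuousOn
  refine ⟨max M3 0 * M1 + M2 * R ^ 2 + M1 * M2 * R, by positivity, fun x hx hxR y hy => ?_⟩
  have hr : 0 < ‖x‖ := norm_pos_iff.mpr hx
  have hb : ball x (‖x‖/2) ⊆ closedBall (0:EN N) (2*R) := by
    intro z hz
    rw [mem_ball, dist_eq_norm] at hz
    have h1 : ‖z‖ ≤ ‖x‖ + ‖z - x‖ := by
      calc ‖z‖ = ‖x + (z - x)‖ := by congr 1; abel
        _ ≤ _ := norm_add_le _ _
    rw [mem_closedBall_zero_iff]; linarith
  obtain ⟨a1, a2⟩ := h1 x hx y hy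
  obtain ⟨-, a3⟩ := h1 x hx (-y) (by rwa [norm_neg])
  obtain ⟨b1, b2⟩ := h2 x _ hb y hy
  obtain ⟨-, b3⟩ := h2 x _ hb (-y) (by rwa [norm_neg])
  have c1 : |v x| ≤ max M3 0 := (hM3 x (by rwa [mem_closedBall_zero_iff])).trans (le_max_left _ _)
  rw [norm_neg, ← sub_eq_add_neg] at a3 b3
  have key : wdS (fun z : EN N => ‖z‖ ^ τ * v z) x y =
      v x * wdS (fun z : EN N => ‖z‖ ^ τ) x y + ‖x‖ ^ τ * wdS v x y -
      ((‖x + y‖ ^ τ - ‖x‖ ^ τ) * (v (x + y) - v x) +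
        (‖x - y‖ ^ τ - ‖x‖ ^ τ) * (v (x - y) - v x)) / 2 := by
    unfold wdS; ring
  have e1 : ‖x‖ ^ τ = ‖x‖ ^ (τ - 2) * ‖x‖ ^ 2 := by
    rw [← Real.rpow_two, ← Real.rpow_add hr]; congr 1; ring
  have e2 : ‖x‖ ^ (τ - 1) = ‖x‖ ^ (τ - 2) * ‖x‖ := by
    nth_rewrite 3 [← Real.rpow_one ‖x‖]
    rw [← Real.rpow_add hr]; congr 1; ring
  have hX : 0 < ‖x‖ ^ (τ - 2) := by positivity
  set X := ‖x‖ ^ (τ - 2)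
  have f1 : |v x * wdS (fun z : EN N => ‖z‖ ^ τ) x y| ≤ max M3 0 * (M1 * X * ‖y‖ ^ 2) := by
    rw [abs_mul]; gcongr
  have f2 : |‖x‖ ^ τ * wdS v x y| ≤ X * R ^ 2 * (M2 * ‖y‖ ^ 2) := by
    rw [abs_mul, abs_of_pos (by positivity), e1]; gcongr
  have f3 : |(‖x + y‖ ^ τ - ‖x‖ ^ τ) * (v (x + y) - v x)| ≤ (M1 * (X * R) * ‖y‖) * (M2 * ‖y‖) := by
    rw [abs_mul]
    rw [e2] at a2
    gcongr
    exact a2.trans (by gcongr)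
  have f4 : |(‖x - y‖ ^ τ - ‖x‖ ^ τ) * (v (x - y) - v x)| ≤ (M1 * (X * R) * ‖y‖) * (M2 * ‖y‖) := by
    rw [abs_mul]
    rw [e2] at a3
    gcongr
    exact a3.trans (by gcongr)
  rw [key]
  rw [abs_le] at f1 f2 f3 f4 ⊢
  constructor <;> nlinarith

/-! The Riesz formula -/

lemma wd_gamma_memL1w {N : ℕ} (hN : 2 ≤ N) {s τ : ℝ} (hτ : -(N:ℝ) < τ) (hτ2 : τ < 2*s) :
    MemL1w N s (fun z => ‖z‖ ^ τ) := by
  unfold MemL1w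
  obtain ⟨C, -, hC⟩ := wd_ext hN (a := τ - ((N:ℝ) + 2*s)) (by linarith)
  obtain ⟨C', -, hC'⟩ := wd_ball hN hτ
  have hm : Measurable (fun x : EN N => ‖x‖ ^ τ / (1 + ‖x‖ ^ ((N:ℝ) + 2*s))) := by fun_prop
  rw [← integrableOn_univ, ← compl_union_self {z : EN N | 1 ≤ ‖z‖}, integrableOn_union]
  constructor
  · have hb : {z : EN N | 1 ≤ ‖z‖}ᶜ = ball 0 1 := by ext z; simp
    rw [hb]
    refine Integrable.mono' (hC' 1 one_pos).1 hm.aestronglyMeasurable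
      (ae_of_all _ fun z => ?_)
    have : 0 ≤ ‖z‖ ^ ((N:ℝ) + 2*s) := by positivity
    rw [Real.norm_of_nonneg (by positivity)]
    exact div_le_self (by positivity) (by linarith)
  · refine Integrable.mono' (hC 1 one_pos).1 hm.aestronglyMeasurable ?_
    filter_upwards [ae_restrict_mem (wd_ext_meas 1)] with z hz
    have hz0 : 0 < ‖z‖ := lt_of_lt_of_le one_pos hz
    have : 0 < ‖z‖ ^ ((N:ℝ) + 2*s) := by positivity
    rw [Real.norm_of_nonneg (by positivity), Real.rpow_sub hz0]
    gcongr
    linarith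

/-- Symmetric difference of the Gaussian. -/
def wdD {N : ℕ} (x : EN N) (l : ℝ) (y : EN N) : ℝ :=
  Real.exp (-(l * ‖x‖ ^ 2)) - (Real.exp (-(l * ‖x + y‖ ^ 2)) + Real.exp (-(l * ‖x - y‖ ^ 2))) / 2

lemma wd_cosh_bound (q : ℝ) : Real.cosh q - 1 ≤ q ^ 2 / 2 * Real.exp |q| := by
  have h1 : ∀ x : ℝ, 0 ≤ x → Real.sinh x ≤ x * Real.exp x := by
    intro x hx
    have e1 := Real.add_one_le_exp (-(2*x))
    have e2 : Real.exp (-x) = Real.exp x * Real.exp (-(2*x)) := by rw [← Real.exp_add]; ring_nf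
    rw [Real.sinh_eq, e2]
    nlinarith [Real.exp_pos x]
  have h2 : Real.cosh q = 1 + 2 * Real.sinh (|q|/2) ^ 2 := by
    rw [← Real.cosh_abs q]
    have : |q| = 2 * (|q|/2) := by ring
    rw [this, Real.cosh_two_mul, Real.cosh_sq]
    ring_nf
  have h3 := h1 (|q|/2) (by positivity)
  have h4 : 0 ≤ Real.sinh (|q|/2) := Real.sinh_nonneg_iff.mpr (by positivity)
  have h5 : Real.sinh (|q|/2) ^ 2 ≤ (|q|/2 * Real.exp (|q|/2)) ^ 2 := by gcongr
  have h6 : Real.exp (|q|/2) ^ 2 = Real.exp |q| := by rw [← Real.exp_nat_mul]; push_cast; ring_nf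
  rw [mul_pow, h6, div_pow, sq_abs] at h5
  rw [h2]; nlinarith

lemma wd_D_near {N : ℕ} (x : EN N) {l : ℝ} (hl : 0 < l) {y : EN N} (hy : ‖y‖ ≤ ‖x‖ / 4) :
    |wdD x l y| ≤ (l + 2 * l ^ 2 * ‖x‖ ^ 2) * Real.exp (-(l * ‖x‖ ^ 2 / 2)) * ‖y‖ ^ 2 := by
  set r := ‖x‖ with hr
  have hr0 : 0 ≤ r := norm_nonneg x
  set q := 2 * l * inner ℝ x y with hq
  have e : wdD x l y = Real.exp (-(l * r ^ 2)) * (1 - Real.exp (-(l * ‖y‖ ^ 2)) * Real.cosh q) := by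
    unfold wdD
    rw [norm_add_sq_real, norm_sub_sq_real, Real.cosh_eq, ← hr,
      show -(l * (r ^ 2 + 2 * inner ℝ x y + ‖y‖ ^ 2)) = -(l * r ^ 2) + -(l * ‖y‖ ^ 2) + -q by
        rw [hq]; ring,
      show -(l * (r ^ 2 - 2 * inner ℝ x y + ‖y‖ ^ 2)) = -(l * r ^ 2) + -(l * ‖y‖ ^ 2) + q by
        rw [hq]; ring]
    simp only [Real.exp_add]
    ring
  have hin : |inner ℝ x y| ≤ r * ‖y‖ := abs_real_inner_le_norm x y
  have hqa : |q| = 2 * l * |inner ℝ x y| := by rw [hq, abs_mul, abs_of_pos (by positivity)]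
  have hq1 : |q| ≤ l * r ^ 2 / 2 := by
    rw [hqa]
    have : r * ‖y‖ ≤ r * (r / 4) := by gcongr
    nlinarith
  have hq2 : q ^ 2 ≤ 4 * l ^ 2 * r ^ 2 * ‖y‖ ^ 2 := by
    rw [← sq_abs, hqa]
    have : |inner ℝ x y| ^ 2 ≤ (r * ‖y‖) ^ 2 := by gcongr
    nlinarith [sq_nonneg l]
  have hc := wd_cosh_bound q
  have hc1 := Real.one_le_cosh q
  have hexp : Real.exp |q| ≤ Real.exp (l * r ^ 2 / 2) := Real.exp_le_exp.mpr hq1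
  have hp0 : 0 ≤ l * ‖y‖ ^ 2 := by positivity
  have he1 : Real.exp (-(l * ‖y‖ ^ 2)) ≤ 1 := Real.exp_le_one_iff.mpr (by linarith)
  have he2 := Real.add_one_le_exp (-(l * ‖y‖ ^ 2))
  have he0 := Real.exp_pos (-(l * ‖y‖ ^ 2))
  have hE1 : 1 ≤ Real.exp (l * r ^ 2 / 2) := Real.one_le_exp (by positivity)
  have hcc : q ^ 2 / 2 * Real.exp |q| ≤ 2 * l ^ 2 * r ^ 2 * ‖y‖ ^ 2 * Real.exp (l * r ^ 2 / 2) := by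
    have : q ^ 2 / 2 ≤ 2 * l ^ 2 * r ^ 2 * ‖y‖ ^ 2 := by linarith
    gcongr
  have hb : |1 - Real.exp (-(l * ‖y‖ ^ 2)) * Real.cosh q| ≤
      (l + 2 * l ^ 2 * r ^ 2) * ‖y‖ ^ 2 * Real.exp (l * r ^ 2 / 2) := by
    have hlo : l * ‖y‖ ^ 2 ≤ l * ‖y‖ ^ 2 * Real.exp (l * r ^ 2 / 2) := le_mul_of_one_le_right hp0 hE1
    have hpos : 0 ≤ 2 * l ^ 2 * r ^ 2 * ‖y‖ ^ 2 * Real.exp (l * r ^ 2 / 2) := by positivity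
    rw [abs_le]
    constructor
    · nlinarith
    · nlinarith
  have hE2 : Real.exp (-(l * r ^ 2)) * Real.exp (l * r ^ 2 / 2) = Real.exp (-(l * r ^ 2 / 2)) := by
    rw [← Real.exp_add]; ring_nf
  rw [e, abs_mul, abs_of_pos (Real.exp_pos _)]
  calc _ ≤ Real.exp (-(l * r ^ 2)) * ((l + 2 * l ^ 2 * r ^ 2) * ‖y‖ ^ 2 * Real.exp (l * r ^ 2 / 2)) := by
        gcongr
    _ = (l + 2 * l ^ 2 * r ^ 2) * (Real.exp (-(l * r ^ 2)) * Real.exp (l * r ^ 2 / 2)) * ‖y‖ ^ 2 := by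
        ring
    _ = _ := by rw [hE2]

lemma wd_sq_rpow {N : ℕ} (z : EN N) (α : ℝ) : (‖z‖ ^ 2) ^ (-α) = ‖z‖ ^ (-(2*α)) := by
  rw [← Real.rpow_two, ← Real.rpow_mul (norm_nonneg _)]; congr 1; ring

lemma wd_D_split {N : ℕ} (x y : EN N) (l k : ℝ) : k * wdD x l y =
    (1/2) * (k * (Real.exp (-(l * ‖x‖ ^ 2)) - Real.exp (-(l * ‖x + y‖ ^ 2)))) +
    (1/2) * (k * (Real.exp (-(l * ‖x‖ ^ 2)) - Real.exp (-(l * ‖x - y‖ ^ 2)))) := by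
  unfold wdD; ring

lemma wd_D_int {N : ℕ} {α : ℝ} (hα : -1 < α) (hα0 : α ≠ 0) {x y : EN N} (hx : x ≠ 0)
    (h1 : x + y ≠ 0) (h2 : x - y ≠ 0) :
    IntegrableOn (fun l : ℝ => l ^ (α - 1) * wdD x l y) (Ioi 0) ∧
    ∫ l in Ioi (0:ℝ), l ^ (α - 1) * wdD x l y =
      Real.Gamma α * wdS (fun z : EN N => ‖z‖ ^ (-(2*α))) x y ∧
    ∫ l in Ioi (0:ℝ), |l ^ (α - 1) * wdD x l y| ≤
      |Real.Gamma α| * ((|‖x‖ ^ (-(2*α)) - ‖x + y‖ ^ (-(2*α))| +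
        |‖x‖ ^ (-(2*α)) - ‖x - y‖ ^ (-(2*α))|) / 2) := by
  have p0 : 0 < ‖x‖ ^ 2 := by have := norm_pos_iff.mpr hx; positivity
  have p1 : 0 < ‖x + y‖ ^ 2 := by have := norm_pos_iff.mpr h1; positivity
  have p2 : 0 < ‖x - y‖ ^ 2 := by have := norm_pos_iff.mpr h2; positivity
  obtain ⟨i1, v1⟩ := wd_frullani hα hα0 p0 p1
  obtain ⟨i2, v2⟩ := wd_frullani hα hα0 p0 p2
  have w1 := wd_frullani_abs hα hα0 p0 p1
  have w2 := wd_frullani_abs hα hα0 p0 p2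
  have hi : IntegrableOn (fun l : ℝ => l ^ (α - 1) * wdD x l y) (Ioi 0) := by
    simp only [wd_D_split]
    exact (i1.const_mul _).add (i2.const_mul _)
  refine ⟨hi, ?_, ?_⟩
  · simp only [wd_D_split]
    rw [integral_add (i1.const_mul _) (i2.const_mul _), integral_const_mul, integral_const_mul, v1, v2,
      wd_sq_rpow, wd_sq_rpow, wd_sq_rpow, wdS]
    ring
  · calc _ ≤ ∫ l in Ioi (0:ℝ), ((1/2) * |l ^ (α - 1) * (Real.exp (-(l * ‖x‖ ^ 2)) - Real.exp (-(l * ‖x + y‖ ^ 2)))| +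
          (1/2) * |l ^ (α - 1) * (Real.exp (-(l * ‖x‖ ^ 2)) - Real.exp (-(l * ‖x - y‖ ^ 2)))|) := by
          refine integral_mono hi.abs ((i1.abs.const_mul _).add (i2.abs.const_mul _)) fun l => ?_
          simp only [wd_D_split]
          refine (abs_add_le _ _).trans ?_
          rw [abs_mul (1/2), abs_mul (1/2), abs_of_pos (by norm_num : (0:ℝ) < 1/2)]
      _ = _ := by
          rw [integral_add (i1.abs.const_mul _) (i2.abs.const_mul _), integral_const_mul,
            integral_const_mul, w1, w2, wd_sq_rpow, wd_sq_rpow, wd_sq_rpow, abs_mul, abs_mul]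
          ring

lemma wd_D_meas {N : ℕ} (x : EN N) : Measurable (fun q : EN N × ℝ => wdD x q.2 q.1) := by
  unfold wdD; fun_prop

lemma wd_D_near_int {N : ℕ} {α : ℝ} (hα : -1 < α) {x : EN N} (hx : x ≠ 0) :
    ∃ C : ℝ, 0 ≤ C ∧ ∀ y : EN N, ‖y‖ ≤ ‖x‖ / 4 →
      ∫ l in Ioi (0:ℝ), |l ^ (α - 1) * wdD x l y| ≤ C * ‖y‖ ^ 2 := by
  have hr : 0 < ‖x‖ := norm_pos_iff.mpr hx
  have hb : 0 < ‖x‖ ^ 2 / 2 := by positivity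
  have i1 := wd_gamma_integrable (a := α + 1) (by linarith) hb
  have i2 := (wd_gamma_integrable (a := α + 2) (by linarith) hb).const_mul (2 * ‖x‖ ^ 2)
  have i3 := i1.add i2
  refine ⟨∫ l in Ioi (0:ℝ), (l ^ (α + 1 - 1) * Real.exp (-(‖x‖ ^ 2 / 2 * l)) +
    2 * ‖x‖ ^ 2 * (l ^ (α + 2 - 1) * Real.exp (-(‖x‖ ^ 2 / 2 * l)))), ?_, fun y hy => ?_⟩
  · refine setIntegral_nonneg measurableSet_Ioi fun l hl => ?_
    have : (0:ℝ) < l := hl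
    positivity
  · rw [← integral_mul_const]
    have hpt : ∀ l ∈ Ioi (0:ℝ), |l ^ (α - 1) * wdD x l y| ≤
        (l ^ (α + 1 - 1) * Real.exp (-(‖x‖ ^ 2 / 2 * l)) +
          2 * ‖x‖ ^ 2 * (l ^ (α + 2 - 1) * Real.exp (-(‖x‖ ^ 2 / 2 * l)))) * ‖y‖ ^ 2 := by
      intro l hl
      have hl' : (0:ℝ) < l := hl
      rw [abs_mul, abs_of_pos (by positivity : 0 < l ^ (α - 1))]
      calc _ ≤ l ^ (α - 1) * ((l + 2 * l ^ 2 * ‖x‖ ^ 2) * Real.exp (-(l * ‖x‖ ^ 2 / 2)) * ‖y‖ ^ 2) := by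
            gcongr; exact wd_D_near x hl' hy
        _ = _ := by
            rw [show α + 1 - 1 = (α - 1) + 1 by ring, show α + 2 - 1 = (α - 1) + 2 by ring,
              Real.rpow_add hl', Real.rpow_add hl', Real.rpow_one, Real.rpow_two,
              show ‖x‖ ^ 2 / 2 * l = l * ‖x‖ ^ 2 / 2 by ring]
            ring
    refine setIntegral_mono_on ?_ (i3.mul_const _) measurableSet_Ioi hpt
    refine Integrable.mono' (i3.mul_const (‖y‖ ^ 2)) ?_ ?_
    · have : Measurable fun l : ℝ => |l ^ (α - 1) * wdD x l y| := by unfold wdD; fun_prop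
      exact this.aestronglyMeasurable
    · filter_upwards [ae_restrict_mem measurableSet_Ioi] with l hl
      rw [Real.norm_eq_abs, abs_abs]; exact hpt l hl

/-- The triple integrand. -/
def wdF {N : ℕ} (α q : ℝ) (x : EN N) (p : EN N × (ℝ × ℝ)) : ℝ :=
  (p.2.2 ^ (α - 1) * wdD x p.2.2 p.1) *
    (p.2.2 ^ q * (p.2.1 ^ (q - 1) * Real.exp (-((p.2.2 * ‖p.1‖ ^ 2) * p.2.1))))

lemma wd_F_meas {N : ℕ} (α q : ℝ) (x : EN N) : Measurable (wdF α q x) := by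
  unfold wdF wdD; fun_prop

/-- The measure on the two scale parameters. -/
abbrev wdnu : Measure (ℝ × ℝ) := (volume.restrict (Ioi (0:ℝ))).prod (volume.restrict (Ioi (0:ℝ)))

lemma wd_kernel_int {N : ℕ} {q : ℝ} (hq : 0 < q) {y : EN N} (hy : y ≠ 0) {l : ℝ} (hl : 0 < l) :
    IntegrableOn (fun v : ℝ => l ^ q * (v ^ (q - 1) * Real.exp (-((l * ‖y‖ ^ 2) * v)))) (Ioi 0) ∧
    ∫ v in Ioi (0:ℝ), l ^ q * (v ^ (q - 1) * Real.exp (-((l * ‖y‖ ^ 2) * v))) =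
      Real.Gamma q * (‖y‖ ^ (2 * q))⁻¹ := by
  have hy0 : 0 < ‖y‖ := norm_pos_iff.mpr hy
  have hb : 0 < l * ‖y‖ ^ 2 := by positivity
  refine ⟨(wd_gamma_integrable hq hb).const_mul _, ?_⟩
  rw [integral_const_mul, Real.integral_rpow_mul_exp_neg_mul_Ioi hq hb, one_div, mul_inv,
    Real.mul_rpow (by positivity) (by positivity), Real.inv_rpow hl.le, Real.inv_rpow (by positivity),
    ← Real.rpow_two, ← Real.rpow_mul hy0.le]
  have : 0 < l ^ q := by positivity
  field_simp

lemma wd_F_slice {N : ℕ} {α q : ℝ} (hα : -1 < α) (hα0 : α ≠ 0) (hq : 0 < q) {x y : EN N}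
    (hx : x ≠ 0) (hy : y ≠ 0) (h1 : x + y ≠ 0) (h2 : x - y ≠ 0) :
    Integrable (fun p : ℝ × ℝ => wdF α q x (y, p)) wdnu ∧
    ∫ p, wdF α q x (y, p) ∂wdnu =
      Real.Gamma q * (‖y‖ ^ (2 * q))⁻¹ * (Real.Gamma α * wdS (fun z : EN N => ‖z‖ ^ (-(2*α))) x y) ∧
    ∫ p, ‖wdF α q x (y, p)‖ ∂wdnu = Real.Gamma q * (‖y‖ ^ (2 * q))⁻¹ *
      ∫ l in Ioi (0:ℝ), |l ^ (α - 1) * wdD x l y| := by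
  obtain ⟨i1, v1, -⟩ := wd_D_int hα hα0 hx h1 h2
  have hm : Measurable (fun p : ℝ × ℝ => wdF α q x (y, p)) :=
    (wd_F_meas α q x).comp measurable_prodMk_left
  have hnorm : ∀ l ∈ Ioi (0:ℝ), ∫ v in Ioi (0:ℝ), ‖wdF α q x (y, (v, l))‖ =
      Real.Gamma q * (‖y‖ ^ (2 * q))⁻¹ * |l ^ (α - 1) * wdD x l y| := by
    intro l hl
    have hl' : (0:ℝ) < l := hl
    rw [← (wd_kernel_int hq hy hl').2, mul_comm, ← integral_const_mul]
    refine setIntegral_congr_fun measurableSet_Ioi fun v hv => ?_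
    have hv' : (0:ℝ) < v := hv
    simp only [wdF]
    rw [norm_mul, Real.norm_eq_abs, Real.norm_of_nonneg (by positivity)]
  have hInt1 : Integrable (fun p : ℝ × ℝ => wdF α q x (y, p)) wdnu := by
    rw [integrable_prod_iff' hm.aestronglyMeasurable]
    constructor
    · filter_upwards [ae_restrict_mem measurableSet_Ioi] with l hl
      have := (wd_kernel_int hq hy hl).1.const_mul (l ^ (α - 1) * wdD x l y)
      simpa only [wdF] using this
    · refine (i1.abs.const_mul (Real.Gamma q * (‖y‖ ^ (2 * q))⁻¹)).congr ?_
      filter_upwards [ae_restrict_mem measurableSet_Ioi] with l hl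
      exact (hnorm l hl).symm
  refine ⟨hInt1, ?_, ?_⟩
  · rw [integral_prod_symm _ hInt1, ← v1, ← integral_const_mul]
    refine setIntegral_congr_fun measurableSet_Ioi fun l hl => ?_
    simp only [wdF]
    rw [integral_const_mul, (wd_kernel_int hq hy hl).2]
    ring
  · rw [integral_prod_symm _ hInt1.norm, ← integral_const_mul]
    exact setIntegral_congr_fun measurableSet_Ioi hnorm

lemma wd_ae_good {N : ℕ} (hN : 2 ≤ N) (x : EN N) :
    ∀ᵐ y : EN N, y ≠ 0 ∧ x + y ≠ 0 ∧ x - y ≠ 0 := by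
  filter_upwards [wd_ne_zero_ae hN 0, wd_ne_zero_ae hN (-x), wd_ne_zero_ae hN x] with y a b c
  refine ⟨a, fun h => b ?_, fun h => c ?_⟩
  · exact (neg_eq_of_add_eq_zero_right h).symm
  · exact (sub_eq_zero.mp h).symm

lemma wd_F_integrable {N : ℕ} (hN : 2 ≤ N) {s α : ℝ} (hs : s ∈ Ioo (0:ℝ) 1) (hα : -s < α)
    (hα0 : α ≠ 0) (hα2 : α < N / 2) {x : EN N} (hx : x ≠ 0) :
    Integrable (wdF α (((N:ℝ) + 2*s)/2) x) (volume.prod wdnu) := by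
  obtain ⟨hs0, hs1⟩ := hs
  set q := ((N:ℝ) + 2*s)/2 with hqd
  have hq : 0 < q := by positivity
  have h2q : 2 * q = (N:ℝ) + 2*s := by rw [hqd]; ring
  have hα1 : -1 < α := by linarith
  have hr : 0 < ‖x‖ := norm_pos_iff.mpr hx
  have hm := (wd_F_meas α q x).aestronglyMeasurable (μ := volume.prod wdnu)
  have hw : MemL1w N s (fun z : EN N => ‖z‖ ^ (-(2*α))) := wd_gamma_memL1w hN (by linarith) (by linarith)
  rw [integrable_prod_iff hm]
  constructor
  · filter_upwards [wd_ae_good hN x] with y hy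
    exact (wd_F_slice hα1 hα0 hq hx hy.1 hy.2.1 hy.2.2).1
  have hm2 : AEStronglyMeasurable (fun y => ∫ p, ‖wdF α q x (y, p)‖ ∂wdnu) volume :=
    hm.norm.integral_prod_right'
  have hGq := Real.Gamma_pos_of_pos hq
  rw [← integrableOn_univ, ← union_compl_self (ball (0:EN N) (‖x‖/4)), integrableOn_union]
  constructor
  · obtain ⟨C1, hC1, h1⟩ := wd_ball hN (a := 2 - ((N:ℝ) + 2*s)) (by linarith)
    obtain ⟨C, hC, h⟩ := wd_D_near_int hα1 hx
    refine Integrable.mono' ((h1 (‖x‖/4) (by positivity)).1.const_mul (Real.Gamma q * C)) hm2.restrict ?_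
    filter_upwards [ae_restrict_mem measurableSet_ball, ae_restrict_of_ae (wd_ae_good hN x)] with y hy hg
    rw [mem_ball_zero_iff] at hy
    have hy0 : 0 < ‖y‖ := norm_pos_iff.mpr hg.1
    rw [Real.norm_of_nonneg (by positivity), (wd_F_slice hα1 hα0 hq hx hg.1 hg.2.1 hg.2.2).2.2,
      Real.rpow_sub hy0, h2q, Real.rpow_two]
    calc _ ≤ Real.Gamma q * (‖y‖ ^ ((N:ℝ) + 2*s))⁻¹ * (C * ‖y‖ ^ 2) := by
          gcongr; exact h y hy.le
      _ = _ := by ring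
  · have hcompl : (ball (0:EN N) (‖x‖/4))ᶜ = {y : EN N | ‖x‖/4 ≤ ‖y‖} := by ext; simp
    rw [hcompl]
    have i1 := (wd_symm_gen x (‖x‖/4) _
      (wd_diff_integrable hN hs0 hw x (‖x‖ ^ (-(2*α))) (by positivity)).abs).1
    refine Integrable.mono' (i1.const_mul (Real.Gamma q * |Real.Gamma α|)) hm2.restrict ?_
    filter_upwards [ae_restrict_of_ae (wd_ae_good hN x)] with y hg
    have hy0 : 0 < ‖y‖ := norm_pos_iff.mpr hg.1
    rw [Real.norm_of_nonneg (by positivity), (wd_F_slice hα1 hα0 hq hx hg.1 hg.2.1 hg.2.2).2.2, h2q,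
      dist_self_add_right, dist_self_sub_right, abs_div, abs_div,
      abs_of_pos (by positivity : 0 < ‖y‖ ^ ((N:ℝ) + 2*s))]
    calc _ ≤ Real.Gamma q * (‖y‖ ^ ((N:ℝ) + 2*s))⁻¹ *
          (|Real.Gamma α| * ((|‖x‖ ^ (-(2*α)) - ‖x + y‖ ^ (-(2*α))| +
            |‖x‖ ^ (-(2*α)) - ‖x - y‖ ^ (-(2*α))|) / 2)) := by
          gcongr; exact (wd_D_int hα1 hα0 hx hg.2.1 hg.2.2).2.2
      _ = _ := by ring

lemma wd_gauss {N : ℕ} {b : ℝ} (hb : 0 < b) :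
    Integrable (fun y : EN N => Real.exp (-(b * ‖y‖ ^ 2))) ∧
    ∫ y : EN N, Real.exp (-(b * ‖y‖ ^ 2)) = (Real.pi / b) ^ ((N:ℝ)/2) := by
  have h := GaussianFourier.integral_rexp_neg_mul_sq_norm (V := EN N) hb
  simp only [neg_mul, finrank_euclideanSpace, Fintype.card_fin] at h
  refine ⟨?_, h⟩
  apply Integrable.of_integral_ne_zero
  rw [h]
  have := Real.pi_pos
  positivity

lemma wd_square {N : ℕ} (x y : EN N) {l v : ℝ} (hl : 0 < l) (hv : 0 < v) :
    Real.exp (-(l * ‖x + y‖ ^ 2)) * Real.exp (-((l * ‖y‖ ^ 2) * v)) =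
      Real.exp (-(l * ‖x‖ ^ 2 * v / (1 + v))) *
        Real.exp (-((l * (1 + v)) * ‖y + (1 / (1 + v)) • x‖ ^ 2)) := by
  rw [← Real.exp_add, ← Real.exp_add]
  congr 1
  rw [norm_add_sq_real, norm_add_sq_real, inner_smul_right, norm_smul, real_inner_comm,
    Real.norm_of_nonneg (by positivity)]
  field_simp
  ring

lemma wd_gauss2 {N : ℕ} (x : EN N) {l v : ℝ} (hl : 0 < l) (hv : 0 < v) :
    Integrable (fun y : EN N => Real.exp (-(l * ‖x + y‖ ^ 2)) * Real.exp (-((l * ‖y‖ ^ 2) * v))) ∧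
    ∫ y : EN N, Real.exp (-(l * ‖x + y‖ ^ 2)) * Real.exp (-((l * ‖y‖ ^ 2) * v)) =
      Real.exp (-(l * ‖x‖ ^ 2 * v / (1 + v))) * (Real.pi / (l * (1 + v))) ^ ((N:ℝ)/2) := by
  obtain ⟨i, e⟩ := wd_gauss (N := N) (b := l * (1 + v)) (by positivity)
  simp only [wd_square x _ hl hv]
  refine ⟨(i.comp_add_right ((1 / (1 + v)) • x)).const_mul _, ?_⟩
  rw [integral_const_mul, ← e]
  congr 1
  exact integral_add_right_eq_self (fun y : EN N => Real.exp (-((l * (1 + v)) * ‖y‖ ^ 2))) _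

lemma wd_D_gauss {N : ℕ} (x : EN N) {l v : ℝ} (hl : 0 < l) (hv : 0 < v) :
    ∫ y : EN N, wdD x l y * Real.exp (-((l * ‖y‖ ^ 2) * v)) =
      Real.exp (-(l * ‖x‖ ^ 2)) * (Real.pi / (l * v)) ^ ((N:ℝ)/2) -
      Real.exp (-(l * ‖x‖ ^ 2 * v / (1 + v))) * (Real.pi / (l * (1 + v))) ^ ((N:ℝ)/2) := by
  obtain ⟨i0, e0⟩ := wd_gauss (N := N) (b := l * v) (by positivity)
  obtain ⟨i1, e1⟩ := wd_gauss2 x hl hv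
  obtain ⟨i2, e2⟩ := wd_gauss2 (-x) hl hv
  rw [norm_neg] at e2
  have hsub : ∀ y : EN N, ‖-x + y‖ = ‖x - y‖ := fun y => by rw [← norm_neg]; congr 1; abel
  simp only [hsub] at i2 e2
  have i0' : Integrable (fun y : EN N => Real.exp (-((l * ‖y‖ ^ 2) * v))) := by
    refine i0.congr (ae_of_all _ fun y => ?_)
    simp only; congr 2; ring
  have e0' : ∫ y : EN N, Real.exp (-((l * ‖y‖ ^ 2) * v)) = (Real.pi / (l * v)) ^ ((N:ℝ)/2) := by
    rw [← e0]; congr 1; funext y; congr 2; ring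
  have : (fun y : EN N => wdD x l y * Real.exp (-((l * ‖y‖ ^ 2) * v))) = fun y =>
      (Real.exp (-(l * ‖x‖ ^ 2)) * Real.exp (-((l * ‖y‖ ^ 2) * v)) -
      ((1/2) * (Real.exp (-(l * ‖x + y‖ ^ 2)) * Real.exp (-((l * ‖y‖ ^ 2) * v))) +
      (1/2) * (Real.exp (-(l * ‖x - y‖ ^ 2)) * Real.exp (-((l * ‖y‖ ^ 2) * v))))) := by
    funext y; unfold wdD; ring
  have i3 := (i1.const_mul (1/2)).add (i2.const_mul (1/2))
  simp only [Pi.add_def] at i3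
  rw [this, integral_sub (i0'.const_mul _) i3,
    integral_add (i1.const_mul _) (i2.const_mul _), integral_const_mul, integral_const_mul,
    integral_const_mul, e0', e1, e2]
  ring

lemma wd_orderB_y {N : ℕ} {s α : ℝ} (x : EN N) {l v : ℝ} (hl : 0 < l) (hv : 0 < v) :
    ∫ y : EN N, wdF α (((N:ℝ) + 2*s)/2) x (y, (v, l)) =
      Real.pi ^ ((N:ℝ)/2) * (v ^ (s - 1) * (l ^ (α + s - 1) * Real.exp (-(‖x‖ ^ 2 * l))) -
        v ^ (((N:ℝ) + 2*s)/2 - 1) * (1 + v) ^ (-((N:ℝ)/2)) *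
          (l ^ (α + s - 1) * Real.exp (-(‖x‖ ^ 2 * (v / (1 + v)) * l)))) := by
  set q := ((N:ℝ) + 2*s)/2 with hq
  have e : (fun y : EN N => wdF α q x (y, (v, l))) = fun y =>
      (l ^ (α - 1) * l ^ q * v ^ (q - 1)) * (wdD x l y * Real.exp (-((l * ‖y‖ ^ 2) * v))) := by
    funext y; simp only [wdF]; ring
  have hp := Real.pi_pos
  have h1 : 0 < 1 + v := by positivity
  rw [e, integral_const_mul, wd_D_gauss x hl hv, Real.div_rpow hp.le (by positivity),
    Real.div_rpow hp.le (by positivity), Real.mul_rpow hl.le hv.le, Real.mul_rpow hl.le h1.le,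
    show l * ‖x‖ ^ 2 * v / (1 + v) = ‖x‖ ^ 2 * (v / (1 + v)) * l by ring, mul_comm l (‖x‖ ^ 2),
    show α + s - 1 = (α - 1) + q - (N:ℝ)/2 by rw [hq]; ring,
    show s - 1 = (q - 1) - (N:ℝ)/2 by rw [hq]; ring,
    Real.rpow_sub hl (α - 1 + q), Real.rpow_add hl (α - 1), Real.rpow_sub hv (q - 1), Real.rpow_neg h1.le]
  have a1 : 0 < l ^ ((N:ℝ)/2) := by positivity
  have a2 : 0 < v ^ ((N:ℝ)/2) := by positivity
  have a3 : 0 < (1 + v) ^ ((N:ℝ)/2) := by positivity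
  field_simp

lemma wd_orderB_l {N : ℕ} {s α : ℝ} (hα : 0 < α + s) {x : EN N} (hx : x ≠ 0) {v : ℝ} (hv : 0 < v) :
    ∫ l in Ioi (0:ℝ), ∫ y : EN N, wdF α (((N:ℝ) + 2*s)/2) x (y, (v, l)) =
      Real.pi ^ ((N:ℝ)/2) * Real.Gamma (α + s) * ‖x‖ ^ (-(2*(α + s))) *
        (v ^ (s + ((N:ℝ)/2 - α - s) - 1) *
          (v ^ (-((N:ℝ)/2 - α - s)) - (1 + v) ^ (-((N:ℝ)/2 - α - s)))) := by
  have hr : 0 < ‖x‖ := norm_pos_iff.mpr hx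
  have h1 : 0 < 1 + v := by positivity
  have b1 : 0 < ‖x‖ ^ 2 := by positivity
  have b2 : 0 < ‖x‖ ^ 2 * (v / (1 + v)) := by positivity
  rw [setIntegral_congr_fun measurableSet_Ioi (fun l hl => wd_orderB_y (s := s) (α := α) x hl hv),
    integral_const_mul, integral_sub ((wd_gamma_integrable hα b1).const_mul _)
      ((wd_gamma_integrable hα b2).const_mul _), integral_const_mul, integral_const_mul,
    Real.integral_rpow_mul_exp_neg_mul_Ioi hα b1, Real.integral_rpow_mul_exp_neg_mul_Ioi hα b2,
    one_div, one_div, Real.inv_rpow b1.le, Real.inv_rpow b2.le, Real.mul_rpow b1.le (by positivity),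
    Real.div_rpow hv.le h1.le, ← wd_sq_rpow, Real.rpow_neg b1.le]
  have f1 : v ^ (s + ((N:ℝ)/2 - α - s) - 1) * v ^ (-((N:ℝ)/2 - α - s)) = v ^ (s - 1) := by
    rw [← Real.rpow_add hv]; congr 1; ring
  have a1 : 0 < v ^ (α + s) := by positivity
  have f2 : v ^ (s + ((N:ℝ)/2 - α - s) - 1) * (1 + v) ^ (-((N:ℝ)/2 - α - s)) =
      v ^ (((N:ℝ) + 2*s)/2 - 1) * (1 + v) ^ (-((N:ℝ)/2)) * (v ^ (α + s) / (1 + v) ^ (α + s))⁻¹ := by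
    rw [show s + ((N:ℝ)/2 - α - s) - 1 = ((N:ℝ) + 2*s)/2 - 1 - (α + s) by ring,
      show -((N:ℝ)/2 - α - s) = -((N:ℝ)/2) + (α + s) by ring,
      Real.rpow_sub hv (((N:ℝ) + 2*s)/2 - 1), Real.rpow_add h1 (-((N:ℝ)/2)), inv_div]
    ring
  rw [mul_sub (v ^ (s + ((N:ℝ)/2 - α - s) - 1)), f1, f2, mul_inv]
  ring

lemma wd_orderB {N : ℕ} (hN : 2 ≤ N) {s α : ℝ} (hs : s ∈ Ioo (0:ℝ) 1) (hα : -s < α)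
    (hα0 : α ≠ 0) (hα2 : α + s < N / 2) {x : EN N} (hx : x ≠ 0) :
    ∫ p, wdF α (((N:ℝ) + 2*s)/2) x p ∂(volume.prod wdnu) =
      Real.pi ^ ((N:ℝ)/2) * Real.Gamma (α + s) * ‖x‖ ^ (-(2*(α + s))) *
        (Real.Gamma ((N:ℝ)/2 - α) * Real.Gamma (1 - s) / (s * Real.Gamma ((N:ℝ)/2 - α - s))) := by
  have hi := wd_F_integrable hN hs hα hα0 (by linarith [hs.1]) hx
  rw [integral_prod_symm _ hi, integral_prod _ hi.integral_prod_right,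
    setIntegral_congr_fun measurableSet_Ioi (fun v hv => wd_orderB_l (by linarith) hx hv),
    integral_const_mul, wd_const_integral hs (by linarith),
    show s + ((N:ℝ)/2 - α - s) = (N:ℝ)/2 - α by ring]

lemma wd_orderA {N : ℕ} (hN : 2 ≤ N) {s α : ℝ} (hs : s ∈ Ioo (0:ℝ) 1) (hα : -s < α)
    (hα0 : α ≠ 0) (hα2 : α < N / 2) {x : EN N} (hx : x ≠ 0) :
    ∫ p, wdF α (((N:ℝ) + 2*s)/2) x p ∂(volume.prod wdnu) =
      Real.Gamma (((N:ℝ) + 2*s)/2) * Real.Gamma α *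
        ∫ y, wdS (fun z : EN N => ‖z‖ ^ (-(2*α))) x y / ‖y‖ ^ ((N:ℝ) + 2*s) := by
  have hi := wd_F_integrable hN hs hα hα0 hα2 hx
  rw [integral_prod _ hi, ← integral_const_mul]
  refine integral_congr_ae ?_
  filter_upwards [wd_ae_good hN x] with y hy
  have hq : 0 < ((N:ℝ) + 2*s)/2 := by have := hs.1; positivity
  rw [(wd_F_slice (by linarith [hs.2]) hα0 hq hx hy.1 hy.2.1 hy.2.2).2.1,
    show 2 * (((N:ℝ) + 2*s)/2) = (N:ℝ) + 2*s by ring]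
  ring

lemma wd_riesz {N : ℕ} (hN : 2 ≤ N) {s τ : ℝ} (hs : s ∈ Ioo (0:ℝ) 1) (hτ : 2*s - N < τ)
    (hτ2 : τ < 2*s) {x : EN N} (hx : x ≠ 0) :
    HasFracLap N s (fun z : EN N => ‖z‖ ^ τ) x (csFun N s τ * ‖x‖ ^ (τ - 2*s)) := by
  have hs0 := hs.1
  have hs1 := hs.2
  have hr : 0 < ‖x‖ := norm_pos_iff.mpr hx
  have hw : MemL1w N s (fun z : EN N => ‖z‖ ^ τ) := wd_gamma_memL1w hN (by linarith) hτ2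
  obtain ⟨C, hC, hb⟩ := wd_bound hN hs
  obtain ⟨M, hM, hb2⟩ := wd_gamma_taylor (N := N) τ
  have hInt1 := (hb _ hw x (‖x‖/2) (M * ‖x‖ ^ (τ - 2)) (by positivity) (by positivity)
    (fun y hy => (hb2 x hx y hy).1)).1
  have hlim := wd_limit hN hs0 hw x hInt1
  rcases eq_or_ne τ 0 with rfl | hτ0
  · convert hlim using 1
    simp [csFun, wdS, Real.Gamma_zero]
  · convert hlim using 1
    have e1 := wd_orderA hN hs (α := -τ/2) (by linarith) (by simpa using hτ0) (by linarith) hx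
    rw [wd_orderB hN hs (α := -τ/2) (by linarith) (by simpa using hτ0) (by linarith) hx] at e1
    rw [show -(2 * (-τ/2)) = τ by ring, show -τ/2 + s = (2*s - τ)/2 by ring,
      show (N:ℝ)/2 - -τ/2 - s = (N - 2*s + τ)/2 by ring,
      show (N:ℝ)/2 - -τ/2 = (N + τ)/2 by ring,
      show -(2 * ((2*s - τ)/2)) = τ - 2*s by ring] at e1
    have g1 : Real.Gamma (-τ/2) ≠ 0 := by
      apply Real.Gamma_ne_zero
      intro m hm
      rcases Nat.eq_zero_or_pos m with rfl | hm0
      · apply hτ0; simp at hm; linarith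
      · have : (1:ℝ) ≤ m := by exact_mod_cast hm0
        linarith
    have g2 : Real.Gamma ((N - 2*s + τ)/2) ≠ 0 := (Real.Gamma_pos_of_pos (by linarith)).ne'
    have g3 : Real.Gamma (1 - s) ≠ 0 := (Real.Gamma_pos_of_pos (by linarith)).ne'
    have hp : 0 < Real.pi ^ ((N:ℝ)/2) := by have := Real.pi_pos; positivity
    set I := ∫ y, wdS (fun z : EN N => ‖z‖ ^ τ) x y / ‖y‖ ^ ((N:ℝ) + 2*s) with hI
    rw [csFun, CNs, show -(N:ℝ)/2 = -((N:ℝ)/2) by ring, Real.rpow_neg Real.pi_pos.le]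
    generalize Real.Gamma (-τ/2) = G1 at *
    generalize Real.Gamma ((N - 2*s + τ)/2) = G2 at *
    generalize Real.Gamma (1 - s) = G3 at *
    generalize Real.Gamma ((N + τ)/2) = G4 at *
    generalize Real.Gamma ((2*s - τ)/2) = G5 at *
    generalize Real.Gamma (((N:ℝ) + 2*s)/2) = G6 at *
    generalize Real.pi ^ ((N:ℝ)/2) = P at *
    generalize ‖x‖ ^ (τ - 2*s) = X at *
    field_simp at e1 ⊢
    linear_combination e1

/-! Part one -/

lemma wd_bdd {N : ℕ} {v : EN N → ℝ} (hv : ContDiff ℝ 2 v) (hc : HasCompactSupport v) :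
    ∃ M : ℝ, 0 ≤ M ∧ ∀ z, |v z| ≤ M := by
  obtain ⟨M, hM⟩ := hc.exists_bound_of_continuous hv.continuous
  exact ⟨M, (norm_nonneg _).trans (hM 0), hM⟩

lemma wd_w_meas {N : ℕ} {τ : ℝ} {v : EN N → ℝ} (hv : ContDiff ℝ 2 v) :
    Measurable (fun z : EN N => ‖z‖ ^ τ * v z) := by
  have := hv.continuous.measurable
  fun_prop

lemma wd_w_memL1w {N : ℕ} (hN : 2 ≤ N) {s τ : ℝ} (hτ : -(N:ℝ) < τ) (hτ2 : τ < 2*s)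
    {v : EN N → ℝ} (hv : ContDiff ℝ 2 v) (hc : HasCompactSupport v) :
    MemL1w N s (fun z => ‖z‖ ^ τ * v z) := by
  obtain ⟨M, hM, hb⟩ := wd_bdd hv hc
  have h := wd_gamma_memL1w hN hτ hτ2
  unfold MemL1w at h ⊢
  have hm := wd_w_meas (τ := τ) hv
  refine Integrable.mono' (h.const_mul M) (Measurable.aestronglyMeasurable (by fun_prop))
    (ae_of_all _ fun z => ?_)
  have h0 : 0 < 1 + ‖z‖ ^ ((N:ℝ) + 2*s) := by positivity
  rw [Real.norm_eq_abs, abs_div, abs_mul, abs_of_pos h0,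
    abs_of_nonneg (by positivity : 0 ≤ ‖z‖ ^ τ), mul_div_assoc', mul_comm (‖z‖ ^ τ)]
  gcongr
  exact hb z

lemma wd_part_one {N : ℕ} (hN : 2 ≤ N) {s μ τ : ℝ} (hs : s ∈ Ioo (0:ℝ) 1)
    (hτ : τ ∈ Ico ((2*s - N)/2) (2*s)) (hc : csFun N s τ = -μ)
    {v : EN N → ℝ} (hv : ContDiff ℝ 2 v) (hcv : HasCompactSupport v) {x : EN N} (hx : x ≠ 0) :
    ∃ L, HasFracLap N s (fun z => ‖z‖ ^ τ * v z) x L ∧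
      HasWFracLap N s τ v x (L + μ / ‖x‖ ^ (2*s) * (‖x‖ ^ τ * v x)) := by
  have hN' : (2:ℝ) ≤ N := by exact_mod_cast hN
  obtain ⟨hs0, hs1⟩ := hs
  obtain ⟨ht1, ht2⟩ := hτ
  have hr : 0 < ‖x‖ := norm_pos_iff.mpr hx
  have hw := wd_w_memL1w hN (s := s) (by linarith) ht2 hv hcv
  have hg : MemL1w N s (fun z : EN N => ‖z‖ ^ τ) := wd_gamma_memL1w hN (by linarith) ht2
  obtain ⟨C, hC, hb⟩ := wd_bound hN ⟨hs0, hs1⟩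
  obtain ⟨M, hM, hb2⟩ := wd_prod_taylor τ hv hr.le
  have hInt1 := (hb _ hw x (‖x‖/2) (M * ‖x‖ ^ (τ - 2)) (by positivity) (by positivity)
    (fun y hy => hb2 x hx le_rfl y hy)).1
  have hlim := wd_limit hN hs0 hw x hInt1
  refine ⟨_, hlim, ?_⟩
  have hri := wd_riesz hN ⟨hs0, hs1⟩ (by linarith) ht2 hx
  rw [hc] at hri
  have hcomb := Tendsto.sub hlim (Tendsto.const_mul (v x) hri)
  unfold HasWFracLap
  have hval : μ / ‖x‖ ^ (2*s) * (‖x‖ ^ τ * v x) = -(v x * (-μ * ‖x‖ ^ (τ - 2*s))) := by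
    rw [Real.rpow_sub hr]; ring
  rw [hval, ← sub_eq_add_neg]
  refine hcomb.congr' ?_
  filter_upwards [self_mem_nhdsWithin] with ε hε
  have hε' : (0:ℝ) < ε := hε
  have i1 := wd_diff_integrable hN hs0 hw x (‖x‖ ^ τ * v x) hε'
  have i2 := (wd_diff_integrable hN hs0 hg x (‖x‖ ^ τ) hε').const_mul (v x)
  rw [mul_left_comm, ← mul_sub, ← integral_const_mul, ← integral_sub i1 i2]
  congr 1
  refine integral_congr_ae (ae_of_all _ fun z => ?_)
  simp only
  ring

/-! Part two -/

lemma wd_gamma_far {N : ℕ} (hN : 2 ≤ N) {s τ : ℝ} (hs : 0 < s) (hτ : -(N:ℝ) < τ) (hτ2 : τ < 2*s) :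
    ∃ C : ℝ, 0 ≤ C ∧ ∀ x : EN N, x ≠ 0 →
      ∫ z in {z : EN N | ‖x‖/2 ≤ dist x z}, ‖z‖ ^ τ / dist x z ^ ((N:ℝ) + 2*s) ≤
        C * ‖x‖ ^ (τ - 2*s) := by
  have hp : 0 < (N:ℝ) + 2*s := by positivity
  set p := (N:ℝ) + 2*s with hpd
  obtain ⟨C1, hC1, h1⟩ := wd_ball hN hτ
  obtain ⟨C2, hC2, h2⟩ := wd_ext hN (a := τ - p) (by rw [hpd]; linarith)
  refine ⟨2 ^ p * C1 + 3 ^ p * C2, by positivity, fun x hx => ?_⟩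
  have hr : 0 < ‖x‖ := norm_pos_iff.mpr hx
  obtain ⟨i1, b1⟩ := h1 ‖x‖ hr
  obtain ⟨i2, b2⟩ := h2 ‖x‖ hr
  have j1 := IntegrableOn.integrable_indicator (i1.const_mul (2 ^ p * ‖x‖ ^ (-p))) measurableSet_ball
  have j2 := IntegrableOn.integrable_indicator (i2.const_mul (3 ^ p)) (wd_ext_meas ‖x‖)
  have j3 := j1.add j2
  have hi := wd_far_integrable hs (wd_gamma_memL1w hN hτ hτ2) x (by positivity : 0 < ‖x‖/2)
  have hn1 : ∀ z, 0 ≤ (ball (0:EN N) ‖x‖).indicator (fun z => 2 ^ p * ‖x‖ ^ (-p) * ‖z‖ ^ τ) z :=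
    fun z => indicator_nonneg (fun z _ => by positivity) z
  have hn2 : ∀ z, 0 ≤ {z : EN N | ‖x‖ ≤ ‖z‖}.indicator (fun z => 3 ^ p * ‖z‖ ^ (τ - p)) z :=
    fun z => indicator_nonneg (fun z _ => by positivity) z
  calc _ ≤ ∫ z in {z : EN N | ‖x‖/2 ≤ dist x z},
        ((ball (0:EN N) ‖x‖).indicator (fun z => 2 ^ p * ‖x‖ ^ (-p) * ‖z‖ ^ τ) z +
          {z : EN N | ‖x‖ ≤ ‖z‖}.indicator (fun z => 3 ^ p * ‖z‖ ^ (τ - p)) z) := by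
        refine setIntegral_mono_on hi j3.integrableOn (wd_distset_meas x _) fun z hz => ?_
        have hz' : ‖x‖/2 ≤ dist x z := hz
        have hd : 0 < dist x z := lt_of_lt_of_le (by positivity) hz'
        by_cases hzx : ‖z‖ < ‖x‖
        · refine le_trans ?_ (le_add_of_nonneg_right (hn2 z))
          rw [indicator_of_mem (by simpa using hzx)]
          have : (‖x‖/2) ^ p ≤ dist x z ^ p := by gcongr
          calc _ ≤ ‖z‖ ^ τ / (‖x‖/2) ^ p := by gcongr
            _ = _ := by
              rw [Real.div_rpow hr.le (by norm_num), Real.rpow_neg hr.le]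
              field_simp
        · refine le_trans ?_ (le_add_of_nonneg_left (hn1 z))
          push Not at hzx
          rw [indicator_of_mem (by simpa using hzx)]
          have hz0 : 0 < ‖z‖ := lt_of_lt_of_le hr hzx
          have h3 : ‖z‖/3 ≤ dist x z := by
            have : ‖z‖ ≤ ‖x‖ + dist x z := by
              rw [dist_eq_norm, norm_sub_rev]
              calc ‖z‖ = ‖x + (z - x)‖ := by congr 1; abel
                _ ≤ _ := norm_add_le _ _
            linarith
          have : (‖z‖/3) ^ p ≤ dist x z ^ p := by gcongr
          calc _ ≤ ‖z‖ ^ τ / (‖z‖/3) ^ p := by gcongr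
            _ = _ := by
              rw [Real.div_rpow hz0.le (by norm_num), Real.rpow_sub hz0]
              field_simp
    _ ≤ ∫ z, ((ball (0:EN N) ‖x‖).indicator (fun z => 2 ^ p * ‖x‖ ^ (-p) * ‖z‖ ^ τ) z +
          {z : EN N | ‖x‖ ≤ ‖z‖}.indicator (fun z => 3 ^ p * ‖z‖ ^ (τ - p)) z) :=
        setIntegral_le_integral j3 (ae_of_all _ fun z => add_nonneg (hn1 z) (hn2 z))
    _ ≤ 2 ^ p * ‖x‖ ^ (-p) * (C1 * ‖x‖ ^ (τ + N)) + 3 ^ p * (C2 * ‖x‖ ^ (τ - p + N)) := by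
        rw [integral_add j1 j2, integral_indicator measurableSet_ball,
          integral_indicator (wd_ext_meas ‖x‖), integral_const_mul, integral_const_mul]
        gcongr
    _ = _ := by
        rw [show τ - 2*s = -p + (τ + N) by rw [hpd]; ring, show τ - p + N = -p + (τ + N) by ring,
          Real.rpow_add hr (-p)]
        ring

lemma wd_w_near {N : ℕ} (hN : 2 ≤ N) {s τ : ℝ} (hs : s ∈ Ioo (0:ℝ) 1) (hτ : -(N:ℝ) < τ)
    (hτ2 : τ < 2*s) {v : EN N → ℝ} (hv : ContDiff ℝ 2 v) (hcv : HasCompactSupport v)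
    {R : ℝ} (hR : 0 ≤ R) :
    ∃ C : ℝ, 0 ≤ C ∧ ∀ x : EN N, x ≠ 0 → ‖x‖ ≤ R → ∀ ε : ℝ, 0 < ε →
      |wdT N s ε (fun z => ‖z‖ ^ τ * v z) x| ≤ C * ‖x‖ ^ (τ - 2*s) := by
  obtain ⟨hs0, hs1⟩ := hs
  have hw := wd_w_memL1w hN (s := s) hτ hτ2 hv hcv
  obtain ⟨C, hC, hb⟩ := wd_bound hN ⟨hs0, hs1⟩
  obtain ⟨M, hM, hb2⟩ := wd_prod_taylor τ hv hR
  obtain ⟨V, hV, hvb⟩ := wd_bdd hv hcv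
  obtain ⟨C', hC', hfar⟩ := wd_gamma_far hN hs0 hτ hτ2
  refine ⟨C * (M + V * 2 ^ (2*s)) + V * C', by positivity, fun x hx hxR ε hε => ?_⟩
  have hr : 0 < ‖x‖ := norm_pos_iff.mpr hx
  have hmain := (hb _ hw x (‖x‖/2) (M * ‖x‖ ^ (τ - 2)) (by positivity) (by positivity)
    (fun y hy => hb2 x hx hxR y hy)).2 ε hε
  refine hmain.trans ?_
  have h1 : M * ‖x‖ ^ (τ - 2) * (‖x‖/2) ^ (2 - 2*s) ≤ M * ‖x‖ ^ (τ - 2*s) := by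
    rw [show τ - 2*s = (τ - 2) + (2 - 2*s) by ring, Real.rpow_add hr, mul_assoc]
    have : (‖x‖/2) ^ (2 - 2*s) ≤ ‖x‖ ^ (2 - 2*s) :=
      Real.rpow_le_rpow (by positivity) (by linarith) (by linarith)
    gcongr
  have h2 : |‖x‖ ^ τ * v x| * (‖x‖/2) ^ (-(2*s)) ≤ V * 2 ^ (2*s) * ‖x‖ ^ (τ - 2*s) := by
    rw [abs_mul, abs_of_pos (by positivity : 0 < ‖x‖ ^ τ), Real.rpow_neg (by positivity),
      Real.div_rpow hr.le (by norm_num), Real.rpow_sub hr, inv_div]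
    calc _ ≤ ‖x‖ ^ τ * V * (2 ^ (2*s) / ‖x‖ ^ (2*s)) := by gcongr; exact hvb x
      _ = _ := by ring
  have h3 : ∫ z in {z : EN N | ‖x‖/2 ≤ dist x z}, |‖z‖ ^ τ * v z| / dist x z ^ ((N:ℝ) + 2*s) ≤
      V * (C' * ‖x‖ ^ (τ - 2*s)) := by
    refine le_trans ?_ (mul_le_mul_of_nonneg_left (hfar x hx) hV)
    rw [← integral_const_mul]
    have i1 := (wd_far_integrable hs0 hw x (by positivity : 0 < ‖x‖/2)).abs
    have i2 := (wd_far_integrable hs0 (wd_gamma_memL1w hN hτ hτ2) x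
      (by positivity : 0 < ‖x‖/2)).const_mul V
    have e : ∀ z : EN N, |(‖z‖ ^ τ * v z) / dist x z ^ ((N:ℝ) + 2*s)| =
        |‖z‖ ^ τ * v z| / dist x z ^ ((N:ℝ) + 2*s) := fun z => by
      rw [abs_div, abs_of_nonneg (by positivity : 0 ≤ dist x z ^ ((N:ℝ) + 2*s))]
    simp only [e] at i1
    refine integral_mono i1 i2 fun z => ?_
    simp only
    rw [abs_mul, abs_of_nonneg (by positivity : 0 ≤ ‖z‖ ^ τ), mul_div_assoc', mul_comm (‖z‖ ^ τ)]
    gcongr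
    exact hvb z
  calc _ ≤ C * (M * ‖x‖ ^ (τ - 2*s) + V * 2 ^ (2*s) * ‖x‖ ^ (τ - 2*s)) +
        V * (C' * ‖x‖ ^ (τ - 2*s)) := by
        exact add_le_add (mul_le_mul_of_nonneg_left (add_le_add h1 h2) hC) h3
    _ = _ := by ring

lemma wd_supp {N : ℕ} {v : EN N → ℝ} (hcv : HasCompactSupport v) :
    ∃ R : ℝ, 0 < R ∧ ∀ x, R ≤ ‖x‖ → v x = 0 := by
  obtain ⟨R, hR⟩ := hcv.isCompact.isBounded.subset_ball 0
  refine ⟨max R 1, by positivity, fun x hx => ?_⟩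
  apply image_eq_zero_of_notMem_tsupport
  intro h
  have := hR h
  rw [mem_ball_zero_iff] at this
  linarith [le_max_left R 1]

lemma wd_w_integrable {N : ℕ} (hN : 2 ≤ N) {τ : ℝ} (hτ : -(N:ℝ) < τ)
    {φ : EN N → ℝ} (hm : Measurable φ) {M R : ℝ} (hb : ∀ x, ‖x‖ < R → |φ x| ≤ M) (hR : 0 < R)
    (hsupp : ∀ x, R ≤ ‖x‖ → φ x = 0) : Integrable (fun z : EN N => ‖z‖ ^ τ * φ z) := by
  obtain ⟨C, hC, h⟩ := wd_ball hN hτ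
  have i := IntegrableOn.integrable_indicator ((h R hR).1.const_mul M) measurableSet_ball
  refine Integrable.mono' i (Measurable.aestronglyMeasurable (by fun_prop)) (ae_of_all _ fun z => ?_)
  by_cases hz : ‖z‖ < R
  · rw [indicator_of_mem (by simpa using hz), Real.norm_eq_abs, abs_mul,
      abs_of_nonneg (by positivity : 0 ≤ ‖z‖ ^ τ), mul_comm]
    gcongr
    exact hb z hz
  · rw [indicator_of_notMem (by simpa using hz), hsupp z (not_lt.mp hz)]
    simp

lemma wd_w_far {N : ℕ} {s : ℝ} (hs : 0 < s) {w : EN N → ℝ} (hw : MemL1w N s w)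
    (hwi : Integrable w) {R : ℝ} (hR : 0 < R) (hsupp : ∀ x, R ≤ ‖x‖ → w x = 0) :
    ∃ C : ℝ, 0 ≤ C ∧ ∀ x : EN N, 2 * R ≤ ‖x‖ → ∀ ε : ℝ, 0 < ε →
      |wdT N s ε w x| ≤ C * (‖x‖ ^ ((N:ℝ) + 2*s))⁻¹ := by
  have hp : 0 < (N:ℝ) + 2*s := by positivity
  set p := (N:ℝ) + 2*s with hpd
  refine ⟨2 ^ p * ∫ z, |w z|, mul_nonneg (by positivity) (integral_nonneg fun z => abs_nonneg _),
    fun x hx ε hε => ?_⟩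
  have hr : 0 < ‖x‖ := by linarith
  unfold wdT
  rw [hsupp x (by linarith)]
  rw [← Real.norm_eq_abs]
  refine (norm_integral_le_integral_norm _).trans ?_
  have i2 := hwi.abs.const_mul (2 ^ p * (‖x‖ ^ p)⁻¹)
  have i1 : IntegrableOn (fun z => ‖(0 - w z) / dist x z ^ p‖) {z : EN N | ε ≤ dist x z} := by
    have := (wd_far_integrable hs hw x hε).norm
    refine this.congr (ae_of_all _ fun z => ?_)
    simp only [zero_sub, neg_div, norm_neg]
    rfl
  calc _ ≤ ∫ z in {z : EN N | ε ≤ dist x z}, 2 ^ p * (‖x‖ ^ p)⁻¹ * |w z| := by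
        refine integral_mono i1 i2.integrableOn fun z => ?_
        simp only [zero_sub, neg_div, norm_neg]
        by_cases hz : R ≤ ‖z‖
        · rw [hsupp z hz]; simp
        · push Not at hz
          have hd : ‖x‖/2 ≤ dist x z := by
            rw [dist_eq_norm]
            linarith [norm_sub_norm_le x z]
          have : (‖x‖/2) ^ p ≤ dist x z ^ p := by gcongr
          rw [norm_div, Real.norm_eq_abs, Real.norm_of_nonneg (by positivity)]
          calc _ ≤ |w z| / (‖x‖/2) ^ p := by gcongr
            _ = _ := by
              rw [Real.div_rpow hr.le (by norm_num)]
              field_simp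
    _ ≤ ∫ z, 2 ^ p * (‖x‖ ^ p)⁻¹ * |w z| :=
        setIntegral_le_integral i2 (ae_of_all _ fun z => by positivity)
    _ = _ := by rw [integral_const_mul]; ring

lemma wd_u_bound {N : ℕ} (hN : 2 ≤ N) {s : ℝ} (hs : s ∈ Ioo (0:ℝ) 1) {u : EN N → ℝ}
    (hu : ContDiff ℝ 2 u) (hu1 : MemL1w N s u) {R : ℝ} (hR : 0 ≤ R) :
    ∃ C : ℝ, 0 ≤ C ∧ ∀ x : EN N, ‖x‖ ≤ R → ∀ ε : ℝ, 0 < ε → |wdT N s ε u x| ≤ C := by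
  obtain ⟨C, hC, hb⟩ := wd_bound hN hs
  obtain ⟨M, hM, ht⟩ := wd_taylor (N := N) isOpen_univ hu.contDiffOn
    (isCompact_closedBall (0 : EN N) (R + 1)) (subset_univ _)
  obtain ⟨K, hK, hk⟩ := wd_kernel_bound (N := N) hs.1 hR one_pos
  obtain ⟨U, hU⟩ := (isCompact_closedBall (0 : EN N) R).exists_bound_of_continuousOn
    hu.continuous.continuousOn
  have hU0 : 0 ≤ U := (norm_nonneg _).trans (hU 0 (by simpa using hR))
  have hIn : 0 ≤ ∫ z, |u z / (1 + ‖z‖ ^ ((N:ℝ) + 2*s))| := integral_nonneg fun z => abs_nonneg _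
  refine ⟨C * (M + U) + K * ∫ z, |u z / (1 + ‖z‖ ^ ((N:ℝ) + 2*s))|, by positivity,
    fun x hx ε hε => ?_⟩
  have hball : ball x 1 ⊆ closedBall 0 (R + 1) := by
    intro z hz
    rw [mem_ball, dist_eq_norm] at hz
    rw [mem_closedBall_zero_iff]
    have : ‖z‖ ≤ ‖x‖ + ‖z - x‖ := by
      calc ‖z‖ = ‖x + (z - x)‖ := by congr 1; abel
        _ ≤ _ := norm_add_le _ _
    linarith
  have := (hb u hu1 x 1 M one_pos hM (fun y hy => (ht x 1 hball y hy).1)).2 ε hε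
  refine this.trans ?_
  rw [Real.one_rpow, Real.one_rpow, mul_one, mul_one]
  have hux : |u x| ≤ U := hU x (by simpa using hx)
  have i1 := (wd_far_integrable hs.1 hu1 x one_pos).abs
  have i2 := (Integrable.abs hu1).const_mul K
  have e : ∀ z : EN N, |u z / dist x z ^ ((N:ℝ) + 2*s)| =
      |u z| / dist x z ^ ((N:ℝ) + 2*s) := fun z => by
    rw [abs_div, abs_of_nonneg (by positivity : 0 ≤ dist x z ^ ((N:ℝ) + 2*s))]
  simp only [e] at i1
  have hfar : ∫ z in {z : EN N | 1 ≤ dist x z}, |u z| / dist x z ^ ((N:ℝ) + 2*s) ≤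
      K * ∫ z, |u z / (1 + ‖z‖ ^ ((N:ℝ) + 2*s))| := by
    rw [← integral_const_mul]
    refine le_trans (setIntegral_mono_on i1 i2.integrableOn (wd_distset_meas x 1) fun z hz => ?_)
      (setIntegral_le_integral i2 (ae_of_all _ fun z => by positivity))
    have hz' : (1:ℝ) ≤ dist x z := hz
    have hd : 0 < dist x z := by linarith
    have hkz := hk x z hx hz'
    have h0 : 0 < 1 + ‖z‖ ^ ((N:ℝ) + 2*s) := by positivity
    have hdp : 0 < dist x z ^ ((N:ℝ) + 2*s) := by positivity
    rw [abs_div, abs_of_pos h0, mul_div_assoc', div_le_div_iff₀ hdp h0]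
    calc _ ≤ |u z| * (K * dist x z ^ ((N:ℝ) + 2*s)) := by gcongr
      _ = _ := by ring
  have := mul_le_mul_of_nonneg_left (add_le_add_right hux M) hC
  linarith

/-- The truncated kernel. -/
def wdk (N : ℕ) (s ε : ℝ) (x z : EN N) : ℝ :=
  {z : EN N | ε ≤ dist x z}.indicator (fun z => (dist x z ^ ((N:ℝ) + 2*s))⁻¹) z

lemma wd_k_meas (N : ℕ) (s ε : ℝ) : Measurable (fun p : EN N × EN N => wdk N s ε p.1 p.2) := by
  have h : (fun p : EN N × EN N => wdk N s ε p.1 p.2) =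
      {p : EN N × EN N | ε ≤ dist p.1 p.2}.indicator
        (fun p => (dist p.1 p.2 ^ ((N:ℝ) + 2*s))⁻¹) := by
    funext p
    simp only [wdk, indicator, mem_ofPred_eq]
  rw [h]
  refine Measurable.indicator (by fun_prop) ?_
  exact (isClosed_le continuous_const continuous_dist).measurableSet

lemma wd_k_symm (N : ℕ) (s ε : ℝ) (x z : EN N) : wdk N s ε x z = wdk N s ε z x := by
  simp only [wdk, indicator, mem_ofPred_eq, dist_comm]

lemma wd_k_nonneg (N : ℕ) (s ε : ℝ) (x z : EN N) : 0 ≤ wdk N s ε x z :=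
  indicator_nonneg (fun _ _ => by positivity) _

lemma wd_k_integral {N : ℕ} {s ε : ℝ} (x : EN N) (f : EN N → ℝ) :
    ∫ z, wdk N s ε x z * f z = ∫ z in {z : EN N | ε ≤ dist x z}, f z / dist x z ^ ((N:ℝ) + 2*s) := by
  rw [← integral_indicator (wd_distset_meas x ε)]
  congr 1
  funext z
  by_cases h : z ∈ {z : EN N | ε ≤ dist x z}
  · simp only [wdk, indicator_of_mem h]; ring
  · simp only [wdk, indicator_of_notMem h]; ring

lemma wd_k_integrable {N : ℕ} {s ε : ℝ} (hs : 0 < s) {f : EN N → ℝ} (hf : MemL1w N s f) (x : EN N)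
    (hε : 0 < ε) : Integrable (fun z => wdk N s ε x z * f z) := by
  have := IntegrableOn.integrable_indicator (wd_far_integrable hs hf x hε) (wd_distset_meas x ε)
  refine this.congr (ae_of_all _ fun z => ?_)
  by_cases h : z ∈ {z : EN N | ε ≤ dist x z}
  · simp only [wdk, indicator_of_mem h]; ring
  · simp only [wdk, indicator_of_notMem h]; ring

lemma wd_T_split {N : ℕ} (hN : 2 ≤ N) {s ε : ℝ} (hs : 0 < s) {f : EN N → ℝ} (hf : MemL1w N s f)
    (x : EN N) (hε : 0 < ε) :
    wdT N s ε f x = f x * (∫ z, wdk N s ε x z) - ∫ z, wdk N s ε x z * f z := by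
  have h1 := wd_k_integrable hs (wd_one_memL1w hN hs) x hε
  have h2 := wd_k_integrable hs hf x hε
  simp only [mul_one] at h1
  unfold wdT
  rw [← wd_k_integral x (fun z => f x - f z), ← integral_const_mul,
    ← integral_sub (h1.const_mul _) h2]
  congr 1
  funext z
  ring

lemma wd_T_meas {N : ℕ} {s ε : ℝ} {f : EN N → ℝ} (hf : Measurable f) :
    AEStronglyMeasurable (fun x => wdT N s ε f x) := by
  have h : (fun x => wdT N s ε f x) = fun x => ∫ z, wdk N s ε x z * (f x - f z) := by
    funext x
    exact (wd_k_integral x (fun z => f x - f z)).symm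
  rw [h]
  have hm : Measurable (fun p : EN N × EN N => wdk N s ε p.1 p.2 * (f p.1 - f p.2)) := by
    have := wd_k_meas N s ε
    fun_prop
  exact (hm.stronglyMeasurable.integral_prod_right').aestronglyMeasurable

lemma wd_prod_integrable {N : ℕ} {s ε : ℝ} (hs : 0 < s) (hε : 0 < ε) {u w : EN N → ℝ}
    (hu : Measurable u) (hu1 : MemL1w N s u) (hw : Measurable w) (hwi : Integrable w)
    {R : ℝ} (hR : 0 < R) (hsupp : ∀ x, R ≤ ‖x‖ → w x = 0) :
    Integrable (fun p : EN N × EN N => wdk N s ε p.1 p.2 * (w p.1 * u p.2)) (volume.prod volume) := by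
  obtain ⟨K, hK, hk⟩ := wd_kernel_bound (N := N) hs hR.le hε
  have hm := wd_k_meas N s ε
  refine Integrable.mono' ((hwi.abs.mul_prod (Integrable.abs hu1)).const_mul K)
    (Measurable.aestronglyMeasurable (by fun_prop)) (ae_of_all _ fun p => ?_)
  obtain ⟨x, z⟩ := p
  simp only
  have h0 : 0 < 1 + ‖z‖ ^ ((N:ℝ) + 2*s) := by positivity
  by_cases hx : R ≤ ‖x‖
  · rw [hsupp x hx]; simp
  push Not at hx
  by_cases h : z ∈ {z : EN N | ε ≤ dist x z}
  · have h' : ε ≤ dist x z := h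
    have hd : 0 < dist x z := by linarith
    have hkz := hk x z hx.le h'
    have hdp : 0 < dist x z ^ ((N:ℝ) + 2*s) := by positivity
    have hi : (dist x z ^ ((N:ℝ) + 2*s))⁻¹ ≤ K / (1 + ‖z‖ ^ ((N:ℝ) + 2*s)) := by
      rw [inv_eq_one_div, div_le_div_iff₀ hdp h0]; linarith
    rw [norm_mul, Real.norm_of_nonneg (wd_k_nonneg N s ε x z), Real.norm_eq_abs, abs_mul, abs_div,
      abs_of_pos h0]
    simp only [wdk, indicator_of_mem h]
    calc _ ≤ K / (1 + ‖z‖ ^ ((N:ℝ) + 2*s)) * (|w x| * |u z|) := by gcongr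
      _ = _ := by ring
  · simp only [wdk, indicator_of_notMem h, zero_mul, norm_zero]
    positivity

lemma wd_fubini {N : ℕ} (hN : 2 ≤ N) {s ε : ℝ} (hs : 0 < s) (hε : 0 < ε) {u w : EN N → ℝ}
    (hu : Measurable u) (hu1 : MemL1w N s u) (hw : Measurable w) (hwi : Integrable w)
    (hw1 : MemL1w N s w)
    {R : ℝ} (hR : 0 < R) (hsupp : ∀ x, R ≤ ‖x‖ → w x = 0)
    (i1 : Integrable (fun x => w x * wdT N s ε u x))
    (i2 : Integrable (fun x => u x * wdT N s ε w x)) :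
    ∫ x, w x * wdT N s ε u x = ∫ x, u x * wdT N s ε w x := by
  have hp := wd_prod_integrable hs hε hu hu1 hw hwi hR hsupp
  rw [← sub_eq_zero, ← integral_sub i1 i2]
  have e : ∀ x, w x * wdT N s ε u x - u x * wdT N s ε w x =
      (∫ z, wdk N s ε z x * (w z * u x)) - ∫ z, wdk N s ε x z * (w x * u z) := by
    intro x
    rw [wd_T_split hN hs hu1 x hε, wd_T_split hN hs hw1 x hε]
    have a1 : ∫ z, wdk N s ε z x * (w z * u x) = u x * ∫ z, wdk N s ε x z * w z := by
      rw [← integral_const_mul]; congr 1; funext z; rw [wd_k_symm]; ring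
    have a2 : ∫ z, wdk N s ε x z * (w x * u z) = w x * ∫ z, wdk N s ε x z * u z := by
      rw [← integral_const_mul]; congr 1; funext z; ring
    rw [a1, a2]; ring
  simp only [e]
  have j1 : Integrable (fun x => ∫ z, wdk N s ε z x * (w z * u x)) := hp.integral_prod_right
  have j2 : Integrable (fun x => ∫ z, wdk N s ε x z * (w x * u z)) := hp.integral_prod_left
  rw [integral_sub j1 j2, sub_eq_zero]
  have k1 := integral_prod _ hp
  have k2 := integral_prod_symm _ hp
  simp only at k1 k2
  rw [← k1, ← k2]

lemma wd_dct {N : ℕ} {F : ℕ → EN N → ℝ} {f b : EN N → ℝ} (hF : ∀ n, AEStronglyMeasurable (F n))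
    (hb : Integrable b) (h : ∀ n, ∀ᵐ x, |F n x| ≤ b x)
    (hl : ∀ᵐ x, Tendsto (fun n => F n x) atTop (𝓝 (f x))) :
    (∀ n, Integrable (F n)) ∧ Integrable f ∧
      Tendsto (fun n => ∫ x, F n x) atTop (𝓝 (∫ x, f x)) := by
  refine ⟨fun n => hb.mono' (hF n) (h n), ?_, ?_⟩
  · refine hb.mono' (aestronglyMeasurable_of_tendsto_ae atTop hF hl) ?_
    filter_upwards [hl, ae_all_iff.mpr h] with x hx hx2
    exact le_of_tendsto hx.norm (Eventually.of_forall hx2)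
  · exact tendsto_integral_of_dominated_convergence b hF hb h hl

lemma wd_uB {N : ℕ} (hN : 2 ≤ N) {s τ : ℝ} (hs : 0 < s) (hτ : -(N:ℝ) < τ - 2*s)
    {u : EN N → ℝ} (hu : Continuous u) (hu1 : MemL1w N s u) {R C1 C2 : ℝ} (hR : 0 < R) :
    Integrable (fun x => |u x| * ({z : EN N | R ≤ ‖z‖}.indicator
        (fun x => C2 * (‖x‖ ^ ((N:ℝ) + 2*s))⁻¹) x +
      (ball (0:EN N) R).indicator (fun x => C1 * ‖x‖ ^ (τ - 2*s)) x)) := by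
  have hm := hu.measurable
  obtain ⟨C, hC, h⟩ := wd_ball hN hτ
  obtain ⟨U, hU⟩ := (isCompact_closedBall (0 : EN N) R).exists_bound_of_continuousOn
    hu.continuousOn
  have k1 : IntegrableOn (fun x => |u x| * (C2 * (‖x‖ ^ ((N:ℝ) + 2*s))⁻¹)) {z : EN N | R ≤ ‖z‖} := by
    have := ((wd_far_integrable hs hu1 0 hR).abs).const_mul C2
    simp only [dist_zero_left] at this
    refine this.congr (ae_of_all _ fun z => ?_)
    simp only
    rw [abs_div, abs_of_nonneg (by positivity : 0 ≤ ‖z‖ ^ ((N:ℝ) + 2*s))]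
    ring
  have k2 : IntegrableOn (fun x => |u x| * (C1 * ‖x‖ ^ (τ - 2*s))) (ball (0:EN N) R) := by
    refine Integrable.mono' ((h R hR).1.const_mul (U * |C1|))
      (Measurable.aestronglyMeasurable (by fun_prop)) ?_
    filter_upwards [ae_restrict_mem measurableSet_ball] with z hz
    have : |u z| ≤ U := hU z (ball_subset_closedBall hz)
    rw [Real.norm_eq_abs, abs_mul, abs_abs, abs_mul,
      abs_of_nonneg (by positivity : 0 ≤ ‖z‖ ^ (τ - 2*s)), mul_assoc]
    gcongr
  have j1 := IntegrableOn.integrable_indicator k1 (wd_ext_meas R)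
  have j2 := IntegrableOn.integrable_indicator k2 measurableSet_ball
  refine (j1.add j2).congr (ae_of_all _ fun x => ?_)
  simp only [Pi.add_apply, indicator]
  split_ifs <;> ring

lemma wd_part_two {N : ℕ} (hN : 2 ≤ N) {s μ τ : ℝ} (hs : s ∈ Ioo (0:ℝ) 1)
    (hτ : τ ∈ Ico ((2*s - N)/2) (2*s)) (hc : csFun N s τ = -μ)
    {v : EN N → ℝ} (hv : ContDiff ℝ 2 v) (hcv : HasCompactSupport v)
    {u : EN N → ℝ} (hu : ContDiff ℝ 2 u) (hu1 : MemL1w N s u)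
    {g : EN N → ℝ} (hg : ∀ x, HasFracLap N s u x (g x))
    {h : EN N → ℝ} (hh : ∀ x : EN N, x ≠ 0 → HasWFracLap N s τ v x (h x)) :
    Integrable (fun x : EN N => v x * (g x + μ / ‖x‖ ^ (2*s) * u x) * ‖x‖ ^ τ) ∧
    Integrable (fun x : EN N => u x * h x) ∧
    ∫ x : EN N, v x * (g x + μ / ‖x‖ ^ (2*s) * u x) * ‖x‖ ^ τ = ∫ x : EN N, u x * h x := by
  have hN' : (2:ℝ) ≤ N := by exact_mod_cast hN
  have hs0 := hs.1
  have hs1 := hs.2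
  have ht1 := hτ.1
  have ht2 := hτ.2
  have hτN : -(N:ℝ) < τ := by linarith
  have hτN2 : -(N:ℝ) < τ - 2*s := by linarith
  obtain ⟨R, hR, hsv⟩ := wd_supp hcv
  obtain ⟨V, hV, hvb⟩ := wd_bdd hv hcv
  set w : EN N → ℝ := fun z => ‖z‖ ^ τ * v z with hwd
  have hwm : Measurable w := wd_w_meas hv
  have hw1 : MemL1w N s w := wd_w_memL1w hN hτN ht2 hv hcv
  have hsw : ∀ x, R ≤ ‖x‖ → w x = 0 := fun x hx => by simp only [hwd, hsv x hx, mul_zero]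
  have hwi : Integrable w := wd_w_integrable hN hτN hv.continuous.measurable (fun x _ => hvb x) hR hsv
  have hum : Measurable u := hu.continuous.measurable
  obtain ⟨Cu, hCu, hub⟩ := wd_u_bound hN hs hu hu1 hR.le
  obtain ⟨C1, hC1, hn⟩ := wd_w_near hN hs hτN ht2 hv hcv (by positivity : 0 ≤ 2 * R)
  obtain ⟨C2, hC2, hf⟩ := wd_w_far hs0 hw1 hwi hR hsw
  set B : EN N → ℝ := fun x => ({z : EN N | 2 * R ≤ ‖z‖}.indicator
        (fun x => C2 * (‖x‖ ^ ((N:ℝ) + 2*s))⁻¹) x +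
      (ball (0:EN N) (2 * R)).indicator (fun x => C1 * ‖x‖ ^ (τ - 2*s)) x) with hB
  have hBi : Integrable (fun x => |u x| * B x) := wd_uB hN hs0 hτN2 hu.continuous hu1 (by positivity)
  have hBb : ∀ x : EN N, x ≠ 0 → ∀ ε : ℝ, 0 < ε → |wdT N s ε w x| ≤ B x := by
    intro x hx ε hε
    by_cases hxR : 2 * R ≤ ‖x‖
    · simp only [hB]
      rw [indicator_of_mem (by simpa using hxR), indicator_of_notMem (by simpa using hxR), add_zero]
      exact hf x hxR ε hε
    · simp only [hB]
      push Not at hxR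
      rw [indicator_of_notMem (by simpa using hxR), indicator_of_mem (by simpa using hxR), zero_add]
      exact hn x hx hxR.le ε hε
  set e : ℕ → ℝ := fun n => 1 / ((n:ℝ) + 1) with he
  have he0 : ∀ n, 0 < e n := fun n => by simp only [he]; positivity
  have het : Tendsto e atTop (𝓝[>] 0) :=
    tendsto_nhdsWithin_iff.mpr ⟨tendsto_one_div_add_atTop_nhds_zero_nat,
      Eventually.of_forall fun n => he0 n⟩
  set c := CNs N s with hcd
  obtain ⟨a1, a2, a3⟩ := wd_dct (F := fun n x => c * (w x * wdT N s (e n) u x))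
    (f := fun x => w x * g x) (b := fun x => |c| * (|w x| * Cu))
    (fun n => (hwm.aestronglyMeasurable.mul (wd_T_meas hum)).const_mul c)
    ((hwi.abs.mul_const _).const_mul _)
    (fun n => ae_of_all _ fun x => by
      rw [abs_mul, abs_mul]
      by_cases hx : R ≤ ‖x‖
      · rw [hsw x hx]; simp
      · push Not at hx
        gcongr
        exact hub x hx.le _ (he0 n))
    (ae_of_all _ fun x => by
      have := ((hg x).comp het).const_mul (w x)
      refine this.congr fun n => ?_
      simp only [Function.comp, wdT]
      ring)
  obtain ⟨b1, b2, b3⟩ := wd_dct (F := fun n x => c * (u x * wdT N s (e n) w x))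
    (f := fun x => u x * (h x - μ / ‖x‖ ^ (2*s) * w x)) (b := fun x => |c| * (|u x| * B x))
    (fun n => (hum.aestronglyMeasurable.mul (wd_T_meas hwm)).const_mul c)
    (hBi.const_mul _)
    (fun n => by
      filter_upwards [wd_ne_zero_ae hN 0] with x hx
      rw [abs_mul, abs_mul]
      gcongr
      exact hBb x hx _ (he0 n))
    (by
      filter_upwards [wd_ne_zero_ae hN 0] with x hx
      obtain ⟨L, hL1, hL2⟩ := wd_part_one hN hs hτ hc hv hcv hx
      have hLe : h x = L + μ / ‖x‖ ^ (2*s) * (‖x‖ ^ τ * v x) := tendsto_nhds_unique (hh x hx) hL2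
      have : h x - μ / ‖x‖ ^ (2*s) * w x = L := by rw [hLe]; simp only [hwd]; ring
      rw [this]
      have := (Tendsto.comp hL1 het).const_mul (u x)
      refine this.congr fun n => ?_
      simp only [Function.comp, wdT, hwd]
      ring)
  have hCs : c ≠ 0 := by
    have g1 : 0 < Real.Gamma (1 - s) := Real.Gamma_pos_of_pos (by linarith)
    have g2 : 0 < Real.Gamma ((N + 2*s)/2) := Real.Gamma_pos_of_pos (by positivity)
    have := Real.pi_pos
    rw [hcd, CNs]
    positivity
  have hcancel : ∀ F : EN N → ℝ, Integrable (fun x => c * F x) → Integrable F := by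
    intro F hF
    refine (hF.const_mul c⁻¹).congr (ae_of_all _ fun x => ?_)
    simp only
    field_simp
  have heq : ∀ n, ∫ x, c * (w x * wdT N s (e n) u x) = ∫ x, c * (u x * wdT N s (e n) w x) := by
    intro n
    rw [integral_const_mul, integral_const_mul,
      wd_fubini hN hs0 (he0 n) hum hu1 hwm hwi hw1 hR hsw (hcancel _ (a1 n)) (hcancel _ (b1 n))]
  have hlim : ∫ x, w x * g x = ∫ x, u x * (h x - μ / ‖x‖ ^ (2*s) * w x) := by
    refine tendsto_nhds_unique a3 (b3.congr fun n => ?_)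
    exact (heq n).symm
  obtain ⟨U, hU⟩ := (isCompact_closedBall (0 : EN N) R).exists_bound_of_continuousOn
    hu.continuous.continuousOn
  have hA : Integrable (fun x => u x * (μ / ‖x‖ ^ (2*s) * w x)) := by
    have := (wd_w_integrable hN hτN2 (φ := fun x => u x * v x) (M := U * V) (R := R)
      (hum.mul hv.continuous.measurable) (fun x hx => by
        rw [abs_mul]
        have hux : |u x| ≤ U := hU x (by simpa using hx.le)
        exact mul_le_mul hux (hvb x) (abs_nonneg _) ((abs_nonneg _).trans hux)) hR (fun x hx => by
        simp only [hsv x hx, mul_zero])).const_mul μ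
    refine this.congr ?_
    filter_upwards [wd_ne_zero_ae hN 0] with x hx
    have hr : 0 < ‖x‖ := norm_pos_iff.mpr hx
    simp only [hwd]
    rw [Real.rpow_sub hr]
    ring
  have q1 : (fun x : EN N => v x * (g x + μ / ‖x‖ ^ (2*s) * u x) * ‖x‖ ^ τ) =
      fun x => w x * g x + u x * (μ / ‖x‖ ^ (2*s) * w x) := by
    funext x; simp only [hwd]; ring
  have q2 : (fun x : EN N => u x * h x) = fun x =>
      u x * (h x - μ / ‖x‖ ^ (2*s) * w x) + u x * (μ / ‖x‖ ^ (2*s) * w x) := by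
    funext x; ring
  rw [q1, q2]
  refine ⟨a2.add hA, b2.add hA, ?_⟩
  rw [integral_add a2 hA, integral_add b2 hA, hlim]

/-- Lemma 3.2: the pointwise relation
`L^s_μ (Γ_μ v) = (-Δ)^s_{Γ_μ} v` on `ℝ^N \ {0}` and the duality identity
`∫ v L^s_μ u Γ_μ dx = ∫ u (-Δ)^s_{Γ_μ} v dx`. -/
theorem weighted_operator_duality
    (N : ℕ) (hN : 2 ≤ N) (s : ℝ) (hs : s ∈ Ioo (0:ℝ) 1)
    (μ τp : ℝ) (hμ : mu0 N s ≤ μ)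
    (hτp : τp ∈ Ico ((2*s - N)/2) (2*s)) (hτpc : csFun N s τp = -μ) :
    (∀ v : EN N → ℝ, ContDiff ℝ 2 v → HasCompactSupport v →
      ∀ x : EN N, x ≠ 0 →
        ∃ L : ℝ, HasFracLap N s (fun z : EN N => ‖z‖ ^ τp * v z) x L ∧
          HasWFracLap N s τp v x (L + μ / ‖x‖ ^ (2*s) * (‖x‖ ^ τp * v x))) ∧
    (∀ v : EN N → ℝ, ContDiff ℝ 2 v → HasCompactSupport v →
      ∀ u : EN N → ℝ, ContDiff ℝ 2 u → MemL1w N s u →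
      ∀ g : EN N → ℝ, (∀ x : EN N, HasFracLap N s u x (g x)) →
      ∀ h : EN N → ℝ, (∀ x : EN N, x ≠ 0 → HasWFracLap N s τp v x (h x)) →
        Integrable (fun x : EN N => v x * (g x + μ / ‖x‖ ^ (2*s) * u x) * ‖x‖ ^ τp) ∧
        Integrable (fun x : EN N => u x * h x) ∧
        (∫ x : EN N, v x * (g x + μ / ‖x‖ ^ (2*s) * u x) * ‖x‖ ^ τp) =
          ∫ x : EN N, u x * h x) := by
  exact ⟨fun v hv hcv x hx => wd_part_one hN hs hτp hτpc hv hcv hx,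
    fun v hv hcv u hu hu1 g hg h hh => wd_part_two hN hs hτp hτpc hv hcv hu hu1 hg hh⟩
end
end

section
/- Let N ≥ 2, s ∈ (0,1), and let Ω ⊂ ℝ^N be a bounded domain. (i) If μ > μ_0, then Γ_μ ∈ W^s(Ω). (ii) If 0 ∈ Ω, then Γ_{μ_0} ∉ W^s(Ω). -/
open MeasureTheory Filter Set Topology Metric

noncomputable section

lemma aux1 (τ σ : ℝ) (hσ0 : 0 < σ) (hσ2 : σ ≤ 2) : ∃ C : ℝ, 0 ≤ C ∧ ∀ u : ℝ, 1 ≤ u →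
    (u ^ τ - 1)^2 ≤ C * (u ^ (2*τ-σ) + 1) * (u-1)^σ := by
  set K : ℝ := |τ| * 2 ^ |τ| with hK
  have hK0 : 0 ≤ K := by positivity
  refine ⟨K^2 + 2^σ, by positivity, fun u hu => ?_⟩
  have hu0 : 0 < u := by linarith
  have h2σ : (0:ℝ) < 2^σ := by positivity
  have hup : 0 < u ^ (2*τ-σ) := by positivity
  have hupp : 0 ≤ (u-1) ^ σ := Real.rpow_nonneg (by linarith) _
  rcases le_total u 2 with h | h
  · have hL : |u ^ τ - 1| ≤ K * (u - 1) := by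
      have := Convex.norm_image_sub_le_of_norm_hasDerivWithin_le (f := fun x : ℝ => x ^ τ)
        (f' := fun x => τ * x ^ (τ - 1)) (s := Icc (1:ℝ) 2) (C := K) (x := 1) (y := u)
        (fun x hx => (Real.hasDerivAt_rpow_const (Or.inl (by linarith [hx.1]))).hasDerivWithinAt)
        (fun x hx => by
          have hx0 : 0 < x := by linarith [hx.1]
          rw [Real.norm_eq_abs, abs_mul, abs_of_pos (Real.rpow_pos_of_pos hx0 _)]
          refine mul_le_mul_of_nonneg_left ?_ (abs_nonneg _)
          calc x ^ (τ - 1) ≤ x ^ |τ| := Real.rpow_le_rpow_of_exponent_le hx.1 (by linarith [le_abs_self τ])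
            _ ≤ 2 ^ |τ| := Real.rpow_le_rpow hx0.le hx.2 (abs_nonneg _))
        (convex_Icc 1 2) (by norm_num) ⟨hu, h⟩
      simpa [Real.norm_eq_abs, abs_of_nonneg (sub_nonneg.2 hu)] using this
    have h2 : (u-1)^2 ≤ (u-1)^σ := by
      rcases hu.eq_or_lt with rfl | hlt
      · simp [Real.zero_rpow hσ0.ne']
      · rw [← Real.rpow_natCast (u-1) 2]
        exact Real.rpow_le_rpow_of_exponent_ge (by linarith) (by linarith) (by simpa using hσ2)
    calc (u ^ τ - 1)^2 = |u ^ τ - 1|^2 := (sq_abs _).symm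
      _ ≤ (K * (u-1))^2 := by gcongr
      _ = K^2 * (u-1)^2 := by ring
      _ ≤ K^2 * (u-1)^σ := by gcongr
      _ ≤ (K^2 + 2^σ) * (u ^ (2*τ-σ) + 1) * (u-1)^σ := by
        gcongr
        nlinarith [mul_nonneg (sq_nonneg K) hup.le, mul_pos h2σ hup]
  · have h1 : u ^ σ ≤ 2^σ * (u-1)^σ := by
      rw [← Real.mul_rpow (by norm_num) (by linarith)]
      exact Real.rpow_le_rpow hu0.le (by linarith) hσ0.le
    have h2 : (1:ℝ) ≤ (u-1)^σ := Real.one_le_rpow (by linarith) hσ0.le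
    have h3 : (1:ℝ) ≤ 2^σ := Real.one_le_rpow (by norm_num) hσ0.le
    have h4 : (u^τ)^2 = u ^ (2*τ-σ) * u^σ := by
      rw [← Real.rpow_natCast, ← Real.rpow_mul hu0.le, ← Real.rpow_add hu0]; congr 1; push_cast; ring
    have h5 : 0 < u^τ := by positivity
    calc (u ^ τ - 1)^2 ≤ (u^τ)^2 + 1 := by nlinarith
      _ ≤ u ^ (2*τ-σ) * (2^σ * (u-1)^σ) + 2^σ * (u-1)^σ := by
        rw [h4]; gcongr; nlinarith
      _ = 2^σ * (u ^ (2*τ-σ) + 1) * (u-1)^σ := by ring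
      _ ≤ _ := by gcongr; nlinarith

lemma aux2 (τ σ : ℝ) (hσ0 : 0 < σ) (hσ2 : σ ≤ 2) : ∃ C : ℝ, 0 ≤ C ∧ ∀ r t : ℝ, 0 < r → 0 < t →
    (r ^ τ - t ^ τ)^2 ≤ C * (r ^ (2*τ-σ) + t ^ (2*τ-σ)) * |r-t|^σ := by
  obtain ⟨C, hC, h⟩ := aux1 τ σ hσ0 hσ2
  have key : ∀ r t : ℝ, 0 < t → t ≤ r → 
    (r ^ τ - t ^ τ)^2 ≤ C * (r ^ (2*τ-σ) + t ^ (2*τ-σ)) * |r-t|^σ := by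
    intro r t ht htr
    have hu : 1 ≤ r / t := (one_le_div ht).2 htr
    obtain ⟨u, rfl⟩ : ∃ u, r = u * t := ⟨r/t, by field_simp⟩
    rw [mul_div_cancel_right₀ _ ht.ne'] at hu
    have hu0 : 0 ≤ u := by linarith
    have e1 : u * t - t = (u-1)*t := by ring
    rw [abs_of_nonneg (sub_nonneg.2 htr), e1, Real.mul_rpow hu0 ht.le, Real.mul_rpow hu0 ht.le,
      Real.mul_rpow (by linarith) ht.le]
    have h4 : (t^τ)^2 = t ^ (2*τ-σ) * t^σ := by
      rw [← Real.rpow_natCast, ← Real.rpow_mul ht.le, ← Real.rpow_add ht]; congr 1; push_cast; ring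
    calc _ = (u^τ-1)^2 * (t^τ)^2 := by ring
      _ ≤ (C * (u ^ (2*τ-σ) + 1) * (u-1)^σ) * (t^τ)^2 := by gcongr; exact h u hu
      _ = _ := by rw [h4]; ring
  refine ⟨C, hC, fun r t hr ht => ?_⟩
  rcases le_total t r with h1 | h1
  · exact key r t ht h1
  · have := key t r hr h1
    rw [abs_sub_comm, add_comm (r ^ _)]
    calc _ = (t^τ - r^τ)^2 := by ring
      _ ≤ _ := this


lemma locInt (N : ℕ) (hN : 2 ≤ N) (a : ℝ) (ha : -(N:ℝ) < a) (R : ℝ) (hR : 0 < R) :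
    IntegrableOn (fun x : EN N => ‖x‖ ^ a) (ball 0 R) := by
  have : Nonempty (Fin N) := ⟨⟨0, by omega⟩⟩
  rw [← integrable_indicator_iff measurableSet_ball]
  have h := (integrable_fun_norm_addHaar (volume : Measure (EN N))
    (f := (Iio R).indicator (fun y : ℝ => y ^ a))).2 (by
      rw [finrank_euclideanSpace_fin]
      have h1 : IntegrableOn (fun y : ℝ => y ^ ((N:ℝ) - 1 + a)) (Ioo 0 R) :=
        (intervalIntegral.integrableOn_Ioo_rpow_iff hR).2 (by linarith)
      have h2 := (integrable_indicator_iff measurableSet_Ioo).2 h1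
      refine (h2.integrableOn (s := Ioi 0)).congr_fun (fun y hy => ?_) measurableSet_Ioi
      have hy0 : (0:ℝ) < y := hy
      by_cases hyR : y < R
      · simp only [indicator, mem_Ioo, hy0, hyR, and_self, if_true, mem_Iio, smul_eq_mul]
        rw [Real.rpow_add hy0, ← Real.rpow_natCast, Nat.cast_sub (by omega), Nat.cast_one]
      · simp [indicator, hyR])
  refine h.congr (Eventually.of_forall fun x => ?_)
  simp [indicator]

lemma l1w (N : ℕ) (hN : 2 ≤ N) (s τ : ℝ) (h1 : -(N:ℝ) < τ) (h2 : τ < 2*s) :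
    MemL1w N s (fun x : EN N => ‖x‖ ^ τ) := by
  have : Nonempty (Fin N) := ⟨⟨0, by omega⟩⟩
  refine (integrable_fun_norm_addHaar (volume : Measure (EN N))
    (f := fun y : ℝ => y ^ τ / (1 + y ^ ((N:ℝ) + 2*s)))).2 ?_
  rw [finrank_euclideanSpace_fin]
  have hm : Measurable (fun y : ℝ => y ^ (N-1) • (y ^ τ / (1 + y ^ ((N:ℝ) + 2*s)))) := by
    simp only [smul_eq_mul]; fun_prop
  have e : ∀ y : ℝ, 0 < y → y ^ (N-1) = y ^ ((N:ℝ)-1) := fun y hy => by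
    rw [← Real.rpow_natCast, Nat.cast_sub (by omega), Nat.cast_one]
  rw [← Ioc_union_Ioi_eq_Ioi (zero_le_one (α := ℝ))]
  refine IntegrableOn.union ?_ ?_
  · rw [integrableOn_Ioc_iff_integrableOn_Ioo]
    have h3 : IntegrableOn (fun y : ℝ => y ^ ((N:ℝ) - 1 + τ)) (Ioo 0 1) :=
        (intervalIntegral.integrableOn_Ioo_rpow_iff one_pos).2 (by linarith)
    refine Integrable.mono' h3 hm.aestronglyMeasurable
      (ae_restrict_of_forall_mem measurableSet_Ioo fun y hy => ?_)
    have hy0 : 0 < y := hy.1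
    have hp : 0 < y ^ ((N:ℝ) + 2*s) := by positivity
    rw [Real.norm_of_nonneg (by simp only [smul_eq_mul]; positivity), smul_eq_mul,
      Real.rpow_add hy0 ((N:ℝ)-1) τ, e y hy0]
    exact mul_le_mul_of_nonneg_left (div_le_self (by positivity) (by linarith)) (by positivity)
  · have h3 : IntegrableOn (fun y : ℝ => y ^ (τ - 2*s - 1)) (Ioi 1) :=
        integrableOn_Ioi_rpow_of_lt (by linarith) one_pos
    refine Integrable.mono' h3 hm.aestronglyMeasurable
      (ae_restrict_of_forall_mem measurableSet_Ioi fun y hy => ?_)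
    have hy0 : 0 < y := one_pos.trans hy
    have hp : 0 < y ^ ((N:ℝ) + 2*s) := by positivity
    rw [Real.norm_of_nonneg (by simp only [smul_eq_mul]; positivity), smul_eq_mul, e y hy0]
    calc y ^ ((N:ℝ)-1) * (y ^ τ / (1 + y ^ ((N:ℝ) + 2*s)))
        ≤ y ^ ((N:ℝ)-1) * (y ^ τ / y ^ ((N:ℝ) + 2*s)) := by gcongr; linarith
      _ = y ^ (τ - 2*s - 1) := by
        rw [← Real.rpow_sub hy0, ← Real.rpow_add hy0]; congr 1; ring

lemma prodInt (N : ℕ) (hN : 2 ≤ N) (a b : ℝ) (ha : -(N:ℝ) < a) (hb : -(N:ℝ) < b)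
    (R : ℝ) (hR : 0 < R) :
    IntegrableOn (fun p : EN N × EN N => ‖p.2‖ ^ a * ‖p.1 - p.2‖ ^ b) (ball 0 R ×ˢ ball 0 R) := by
  have hf := (integrable_indicator_iff measurableSet_ball).2 (locInt N hN a ha R hR)
  have hg := (integrable_indicator_iff measurableSet_ball).2 (locInt N hN b hb (2*R) (by linarith))
  have h := hf.convolution_integrand (ContinuousLinearMap.mul ℝ ℝ) hg
  rw [← Measure.volume_eq_prod] at h
  refine (h.integrableOn (s := ball 0 R ×ˢ ball 0 R)).congr_fun (fun p hp => ?_)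
    (measurableSet_ball.prod measurableSet_ball)
  obtain ⟨h1, h2⟩ := hp
  have h3 : p.1 - p.2 ∈ ball (0 : EN N) (2*R) := by
    rw [mem_ball_zero_iff] at *
    linarith [norm_sub_le p.1 p.2]
  simp [indicator_of_mem h2, indicator_of_mem h3]

lemma energyInt (N : ℕ) (hN : 2 ≤ N) (s τ : ℝ) (hs : s ∈ Ioo (0:ℝ) 1)
    (h1 : (2*s - N)/2 < τ) (R : ℝ) (hR : 0 < R) :
    FiniteEnergyOn N s (fun x : EN N => ‖x‖ ^ τ) (ball 0 R) (ball 0 R) := by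
  have : Nonempty (Fin N) := ⟨⟨0, by omega⟩⟩
  obtain ⟨hs0, hs1⟩ := hs
  obtain ⟨ε, hε0, hε⟩ : ∃ ε : ℝ, 0 < ε ∧ ε < min (2 - 2*s) (N + 2*τ - 2*s) :=
    exists_between (lt_min (by linarith) (by linarith))
  obtain ⟨hε1, hε2⟩ := lt_min_iff.1 hε
  obtain ⟨C, hC, h⟩ := aux2 τ (2*s+ε) (by linarith) (by linarith)
  have i1 := prodInt N hN (2*τ - (2*s+ε)) (ε - N) (by linarith) (by linarith) R hR
  have i2 : IntegrableOn (fun p : EN N × EN N =>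
      ‖p.1‖ ^ (2*τ - (2*s+ε)) * ‖p.1 - p.2‖ ^ (ε - N)) (ball 0 R ×ˢ ball 0 R) := by
    unfold IntegrableOn at i1 ⊢
    rw [Measure.volume_eq_prod, ← Measure.prod_restrict] at i1 ⊢
    have := i1.swap
    refine this.congr (Eventually.of_forall fun p => ?_)
    simp [Function.comp, norm_sub_rev]
  have i3 := (i1.add i2).const_mul C
  have n1 : ∀ᵐ p : EN N × EN N, p.1 ≠ 0 := by
    rw [Measure.volume_eq_prod]
    exact Measure.quasiMeasurePreserving_fst.ae (p := fun x : EN N => x ≠ 0)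
      (Measure.ae_ne volume 0)
  have n2 : ∀ᵐ p : EN N × EN N, p.2 ≠ 0 := by
    rw [Measure.volume_eq_prod]
    exact Measure.quasiMeasurePreserving_snd.ae (p := fun x : EN N => x ≠ 0)
      (Measure.ae_ne volume 0)
  refine Integrable.mono' i3 (Measurable.aestronglyMeasurable (by fun_prop)) ?_
  refine ae_restrict_of_ae ?_
  filter_upwards [n1, n2] with p hp1 hp2
  have hq1 := norm_pos_iff.2 hp1
  have hq2 := norm_pos_iff.2 hp2
  have hA : 0 ≤ ‖p.1‖ ^ (2*τ - (2*s+ε)) + ‖p.2‖ ^ (2*τ - (2*s+ε)) := by positivity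
  rw [Real.norm_of_nonneg (by positivity), dist_eq_norm]
  simp only [Pi.add_apply]
  rcases (norm_nonneg (p.1 - p.2)).eq_or_lt with h0 | h0
  · rw [← h0, Real.zero_rpow (by positivity), div_zero]
    positivity
  · rw [div_le_iff₀ (by positivity)]
    calc _ ≤ C * (‖p.1‖ ^ (2*τ - (2*s+ε)) + ‖p.2‖ ^ (2*τ - (2*s+ε)))
              * |‖p.1‖ - ‖p.2‖| ^ (2*s+ε) := h _ _ hq1 hq2
      _ ≤ C * (‖p.1‖ ^ (2*τ - (2*s+ε)) + ‖p.2‖ ^ (2*τ - (2*s+ε)))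
              * ‖p.1 - p.2‖ ^ (2*s+ε) := by
          gcongr
          exact abs_norm_sub_norm_le _ _
      _ = C * (‖p.1‖ ^ (2*τ - (2*s+ε)) + ‖p.2‖ ^ (2*τ - (2*s+ε)))
              * (‖p.1 - p.2‖ ^ (ε - N) * ‖p.1 - p.2‖ ^ (N + 2*s)) := by
          rw [← Real.rpow_add h0]; congr 2; ring
      _ = _ := by ring

lemma energyInf (N : ℕ) (hN : 2 ≤ N) (s : ℝ) (hs : s ∈ Ioo (0:ℝ) 1) (R : ℝ) (hR : 0 < R) :
    ¬ FiniteEnergyOn N s (fun x : EN N => ‖x‖ ^ ((2*s - N)/2)) (ball 0 R) (ball 0 R) := by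
  have : Nonempty (Fin N) := ⟨⟨0, by omega⟩⟩
  obtain ⟨hs0, hs1⟩ := hs
  have hN' : (2:ℝ) ≤ N := by exact_mod_cast hN
  set τ : ℝ := (2*s - N)/2 with hτ
  have hτ0 : τ < 0 := by rw [hτ]; linarith
  intro H
  unfold FiniteEnergyOn at H
  set f : EN N × EN N → ℝ :=
    fun p => (‖p.1‖ ^ τ - ‖p.2‖ ^ τ)^2 / dist p.1 p.2 ^ ((N:ℝ) + 2*s) with hf
  have hf0 : ∀ p, 0 ≤ f p := fun p => by rw [hf]; positivity
  have : (volume : Measure (EN N × EN N)).IsAddHaarMeasure := by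
    rw [Measure.volume_eq_prod]; infer_instance
  rw [ball_prod_same] at H
  have hsub : ball ((0:EN N), (0:EN N)) (R/2) ⊆ ball (0, 0) R := ball_subset_ball (by linarith)
  have hscale : ∀ p, f ((1/2:ℝ) • p) = 2 ^ (N+N) * f p := by
    intro p
    simp only [hf, Prod.smul_fst, Prod.smul_snd, norm_smul, dist_smul₀]
    have e : ‖(1/2:ℝ)‖ = 2⁻¹ := by norm_num
    rw [e, Real.mul_rpow (by norm_num) (norm_nonneg _), Real.mul_rpow (by norm_num) (norm_nonneg _),
      Real.mul_rpow (by norm_num) dist_nonneg, ← mul_sub, mul_pow, mul_div_mul_comm]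
    congr 1
    rw [← Real.rpow_natCast, ← Real.rpow_mul (by norm_num), ← Real.rpow_sub (by norm_num),
      Real.inv_rpow (by norm_num), ← Real.rpow_neg (by norm_num), ← Real.rpow_natCast 2 (N+N)]
    congr 1
    rw [hτ]; push_cast; ring
  have hI := Measure.setIntegral_comp_smul (volume : Measure (EN N × EN N)) f (R := 1/2)
    (ball (0, 0) R) (by norm_num)
  rw [_root_.smul_ball (show (1/2:ℝ) ≠ 0 by norm_num)] at hI
  have e2 : Module.finrank ℝ (EN N × EN N) = N + N := by simp
  have e3 : |((1/2:ℝ) ^ (N+N))⁻¹| = 2 ^ (N+N) := by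
    rw [abs_of_nonneg (by positivity)]; simp
  have e4 : ‖(1/2:ℝ)‖ * R = R/2 := by norm_num; ring
  have e5 : (1/2:ℝ) • ((0:EN N), (0:EN N)) = (0, 0) := by simp
  simp_rw [hscale] at hI
  rw [e2, e3, e4, e5, integral_const_mul, smul_eq_mul] at hI
  have hI' := mul_left_cancel₀ (by positivity) hI
  have hd := setIntegral_sdiff (μ := volume) (f := f) measurableSet_ball H hsub
  rw [hI', sub_self] at hd
  have hpos := (setIntegral_pos_iff_support_of_nonneg_ae (μ := volume)
    (s := ball ((0:EN N), (0:EN N)) R \ ball (0, 0) (R/2)) (f := f)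
    (Eventually.of_forall hf0) (H.mono_set sdiff_subset)).2 ?_
  · exact absurd hd hpos.ne'
  set V : Set (EN N × EN N) := (ball 0 R \ closedBall 0 (R/2)) ×ˢ (ball 0 (R/2) \ {0}) with hV
  have hVo : IsOpen V :=
    (isOpen_ball.sdiff isClosed_closedBall).prod (isOpen_ball.sdiff isClosed_singleton)
  have hVn : V.Nonempty := by
    obtain ⟨x, hx⟩ := exists_norm_eq (EN N) (c := 3/4*R) (by positivity)
    obtain ⟨y, hy⟩ := exists_norm_eq (EN N) (c := 1/4*R) (by positivity)
    refine ⟨(x, y), ⟨?_, ?_⟩, ?_, ?_⟩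
    · simp [hx]; linarith
    · simp [hx]; linarith
    · simp [hy]; linarith
    · have : 0 < ‖y‖ := by rw [hy]; positivity
      simpa using this
  refine (hVo.measure_pos volume hVn).trans_le (measure_mono ?_)
  rintro ⟨x, y⟩ ⟨⟨h1, h2⟩, h3, h4⟩
  simp only [mem_ball_zero_iff, mem_closedBall_zero_iff, not_le, mem_singleton_iff] at h1 h2 h3 h4
  have hy : 0 < ‖y‖ := norm_pos_iff.2 h4
  have hlt : ‖x‖ ^ τ < ‖y‖ ^ τ := Real.rpow_lt_rpow_of_neg hy (by linarith) hτ0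
  have hxy : x ≠ y := by rintro rfl; exact lt_irrefl _ hlt
  refine ⟨?_, ?_, ?_⟩
  · have hdp := dist_pos.2 hxy
    have : 0 < (‖x‖ ^ τ - ‖y‖ ^ τ)^2 := by
      have : ‖x‖ ^ τ - ‖y‖ ^ τ ≠ 0 := by linarith
      positivity
    exact (div_pos this (Real.rpow_pos_of_pos hdp _)).ne'
  · rw [← ball_prod_same]
    exact ⟨by simpa using h1, by simp; linarith⟩
  · rw [← ball_prod_same]
    rintro ⟨h5, -⟩
    simp at h5
    linarith

/-- Lemma 4.2: `Γ_μ ∈ W^s(Ω)` for `μ > μ₀`, while `Γ_{μ₀} ∉ W^s(Ω)`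
whenever `0 ∈ Ω`. -/
theorem gamma_mu_Ws_membership
    (N : ℕ) (hN : 2 ≤ N) (s : ℝ) (hs : s ∈ Ioo (0:ℝ) 1)
    (Ω : Set (EN N)) (hΩ : IsBoundedDomain N Ω) :
    (∀ μ τp : ℝ, mu0 N s < μ → τp ∈ Ico ((2*s - N)/2) (2*s) → csFun N s τp = -μ →
      MemWs N s Ω (fun x : EN N => ‖x‖ ^ τp)) ∧
    ((0:EN N) ∈ Ω → ¬ MemWs N s Ω (fun x : EN N => ‖x‖ ^ ((2*s - N)/2))) := by
  obtain ⟨hs0, hs1⟩ := id hs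
  have hN' : (2:ℝ) ≤ N := by exact_mod_cast hN
  obtain ⟨hO, -, hB⟩ := hΩ
  refine ⟨fun μ τ hμ hτ hc => ?_, fun h0 hW => ?_⟩
  · have hlt : (2*s - N)/2 < τ := by
      refine lt_of_le_of_ne hτ.1 ?_
      rintro rfl
      refine hμ.ne ?_
      rw [← neg_inj, ← hc]
      unfold mu0 csFun
      rw [neg_neg, show ((N:ℝ) + (2*s - N)/2)/2 = (N + 2*s)/4 by ring,
        show (2*s - (2*s - (N:ℝ))/2)/2 = (N + 2*s)/4 by ring,
        show -((2*s - (N:ℝ))/2)/2 = (N - 2*s)/4 by ring,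
        show ((N:ℝ) - 2*s + (2*s - N)/2)/2 = (N - 2*s)/4 by ring]
      ring
    obtain ⟨R, hR, hsub⟩ : ∃ R : ℝ, 0 < R ∧ closure Ω ⊆ ball 0 R := by
      obtain ⟨R, hR, h⟩ := hB.closure.subset_ball_lt 0 0
      exact ⟨R, hR, h⟩
    have hΩs := subset_closure.trans hsub
    refine ⟨l1w N hN s τ (by linarith) hτ.2, ?_, ball 0 R, isOpen_ball,
      ?_, hsub, ?_⟩
    · have := (locInt N hN (τ*2) (by linarith) R hR).mono_set hΩs
      refine this.congr (Eventually.of_forall fun x => ?_)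
      simp only
      rw [Real.rpow_mul (norm_nonneg _), ← Real.rpow_natCast]
      norm_num
    · exact (convex_ball _ _).isConnected (nonempty_ball.2 hR)
    · exact (energyInt N hN s τ hs hlt R hR).mono_set (prod_mono hΩs le_rfl)
  · obtain ⟨-, -, Ω', -, -, hsub, hE⟩ := hW
    obtain ⟨R, hR, hb⟩ := Metric.isOpen_iff.1 hO 0 h0
    exact energyInf N hN s hs R hR
      (hE.mono_set (prod_mono hb (hb.trans (subset_closure.trans hsub))))
end
end
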